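/- arXiv:1404.3911 — 2 statements merged into one kernel-verified Lean document; each statement's English description precedes it below -/
import Mathlib

section
/- Let k be an algebraically closed field and let r ≥ 2 and d₁ ≥ d₂ ≥ ⋯ ≥ d_r ≥ 1 be integers; set d = d₁+⋯+d_r, D = Σ_{1≤i<j≤r} d_i d_j, s = d₂+⋯+d_r, p = D − d₁s. Then the following are equivalent: (a) there exist nonzero homogeneous polynomials F₁,…,F_r, G₁,…,G_r ∈ k[x₀,x₁,x₂] with deg F_i = deg G_i = d_i such that dim_k (I_F ∩ I_G)_d = max{0, C(d+2,2) − 2D}; (b) it is NOT the case that both d₁ ≥ s and 2p − 3s > 0. (This is the ideal-theoretic form, obtained via Terracini's Lemma, of the Main Theorem: the secant line variety σ₂(X_{2,λ}) of the variety of λ-reducible plane curves is defective if and only if d₁ ≥ s and 2p − 3s > 0.) -/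
open MvPolynomial Finset

/-- The ideal `I_F = ⋂_{i<j} (F_i, F_j)` associated to a tuple of forms. -/
noncomputable def idealOfForms {k : Type*} [Field k] {r : ℕ}
    (F : Fin r → MvPolynomial (Fin 3) k) : Ideal (MvPolynomial (Fin 3) k) :=
  ⨅ (i : Fin r) (j : Fin r) (_ : i < j), Ideal.span {F i, F j}

/-- `dim_k (I)_n`, the dimension of the degree-`n` homogeneous part of the ideal `I`. -/
noncomputable def gradedDim {k : Type*} [Field k]
    (I : Ideal (MvPolynomial (Fin 3) k)) (n : ℕ) : ℕ :=
  Module.finrank k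
    ↥(Submodule.restrictScalars k I ⊓ homogeneousSubmodule (Fin 3) k n)

/-- `D = Σ_{1 ≤ i < j ≤ r} d_i d_j`. -/
def Dval {r : ℕ} (d : Fin r → ℕ) : ℕ :=
  ∑ q ∈ univ.filter (fun q : Fin r × Fin r => q.1 < q.2), d q.1 * d q.2

/-- `s = d_2 + ⋯ + d_r`. -/
def sval {r : ℕ} (d : Fin r → ℕ) : ℕ :=
  ∑ i ∈ univ.filter (fun i : Fin r => i.val ≠ 0), d i

/-- `p = Σ_{2 ≤ i < j ≤ r} d_i d_j = D - d_1 s`. -/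
def pval {r : ℕ} (d : Fin r → ℕ) : ℕ :=
  ∑ q ∈ univ.filter (fun q : Fin r × Fin r => q.1 < q.2 ∧ q.1.val ≠ 0), d q.1 * d q.2

section LineOpen

variable {k : Type*} [Field k] {M : Type*} [AddCommGroup M] [Module k M]

/-- A set which contains, with each of its points, all but finitely many points of every line
through that point. -/
def LineOpen (k : Type*) [Field k] {M : Type*} [AddCommGroup M] [Module k M] (S : Set M) : Prop :=
  ∀ v ∈ S, ∀ w : M, ∀ᶠ t : k in Filter.cofinite, v + t • w ∈ S

/-- A nonempty line-open set. -/
def OpenDense (k : Type*) [Field k] {M : Type*} [AddCommGroup M] [Module k M] (S : Set M) : Prop :=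
  LineOpen k S ∧ S.Nonempty

/-- Functions whose restriction to every line is given by a polynomial. -/
def PolyOnLines (k : Type*) [Field k] {M : Type*} [AddCommGroup M] [Module k M]
    (f : M → k) : Prop :=
  ∀ v w : M, ∃ P : Polynomial k, ∀ t : k, f (v + t • w) = P.eval t

theorem LineOpen.inter {S T : Set M} (hS : LineOpen k S) (hT : LineOpen k T) :
    LineOpen k (S ∩ T) :=
  fun v hv w => (hS v hv.1 w).and (hT v hv.2 w)

theorem OpenDense.inter [Infinite k] {S T : Set M} (hS : OpenDense k S) (hT : OpenDense k T) :
    OpenDense k (S ∩ T) := by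
  refine ⟨hS.1.inter hT.1, ?_⟩
  obtain ⟨a, ha⟩ := hS.2
  obtain ⟨b, hb⟩ := hT.2
  have h1 := hS.1 a ha (b - a)
  have h2 := hT.1 b hb (a - b)
  have h3 : ∀ᶠ t : k in Filter.cofinite, b + (1 - t) • (a - b) ∈ T :=
    (sub_right_injective (b := (1 : k))).tendsto_cofinite.eventually h2
  obtain ⟨t, ht1, ht2⟩ := (h1.and h3).exists
  refine ⟨a + t • (b - a), ht1, ?_⟩
  convert ht2 using 1
  module

theorem OpenDense.univ : OpenDense k (Set.univ : Set M) :=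
  ⟨fun _ _ _ => Filter.Eventually.of_forall fun _ => trivial, ⟨0, trivial⟩⟩

theorem OpenDense.forall_mem [Infinite k] {ι : Type*} (A : Finset ι) {S : ι → Set M}
    (h : ∀ a ∈ A, OpenDense k (S a)) : OpenDense k {x | ∀ a ∈ A, x ∈ S a} := by
  classical
  induction A using Finset.induction_on with
  | empty => simpa using OpenDense.univ
  | insert a A _ ih =>
    convert (h a (mem_insert_self a A)).inter (ih fun b hb => h b (mem_insert_of_mem hb)) using 1
    ext x
    simp

theorem OpenDense.imp {p : Prop} {S : Set M} (h : p → OpenDense k S) :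
    OpenDense k {x | p → x ∈ S} := by
  by_cases hp : p
  · simpa [hp] using h hp
  · simpa [hp] using OpenDense.univ

theorem PolyOnLines.add {f g : M → k} (hf : PolyOnLines k f) (hg : PolyOnLines k g) :
    PolyOnLines k (fun x => f x + g x) := fun v w => by
  obtain ⟨P, hP⟩ := hf v w
  obtain ⟨Q, hQ⟩ := hg v w
  exact ⟨P + Q, fun t => by simp [hP, hQ]⟩

theorem PolyOnLines.sub {f g : M → k} (hf : PolyOnLines k f) (hg : PolyOnLines k g) :
    PolyOnLines k (fun x => f x - g x) := fun v w => by
  obtain ⟨P, hP⟩ := hf v w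
  obtain ⟨Q, hQ⟩ := hg v w
  exact ⟨P - Q, fun t => by simp [hP, hQ]⟩

theorem PolyOnLines.mul {f g : M → k} (hf : PolyOnLines k f) (hg : PolyOnLines k g) :
    PolyOnLines k (fun x => f x * g x) := fun v w => by
  obtain ⟨P, hP⟩ := hf v w
  obtain ⟨Q, hQ⟩ := hg v w
  exact ⟨P * Q, fun t => by simp [hP, hQ]⟩

theorem PolyOnLines.linear (f : M →ₗ[k] k) : PolyOnLines k f := fun v w =>
  ⟨Polynomial.C (f v) + Polynomial.C (f w) * Polynomial.X, fun t => by simp [mul_comm t]⟩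

theorem Polynomial.eventually_eval_ne_zero {P : Polynomial k} (hP : P ≠ 0) :
    ∀ᶠ t : k in Filter.cofinite, P.eval t ≠ 0 := by
  have : {t : k | ¬ P.eval t ≠ 0} ⊆ P.rootSet k := fun t ht => by
    simpa [Polynomial.mem_rootSet, hP] using ht
  exact (P.rootSet_finite k).subset this

theorem PolyOnLines.lineOpen {f : M → k} (hf : PolyOnLines k f) : LineOpen k {x | f x ≠ 0} := by
  intro v hv w
  obtain ⟨P, hP⟩ := hf v w
  have hP0 : P ≠ 0 := by
    rintro rfl
    apply hv
    simpa using hP 0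
  filter_upwards [Polynomial.eventually_eval_ne_zero hP0] with t ht
  simpa [hP t] using ht

end LineOpen

section Semicontinuity

variable {k : Type*} [Field k] {W : Type*} [AddCommGroup W] [Module k W]

/-- The common kernel at the parameter `t` of finitely many polynomial families of functionals. -/
noncomputable def familyKer {ι : Type*} (φ : ι → W →ₗ[k] Polynomial k) (t : k) : Submodule k W :=
  ⨅ i, LinearMap.ker ((Polynomial.leval t).comp (φ i))

theorem mem_familyKer {ι : Type*} {φ : ι → W →ₗ[k] Polynomial k} {t : k} {w : W} :
    w ∈ familyKer φ t ↔ ∀ i, (φ i w).eval t = 0 := by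
  simp [familyKer, Submodule.mem_iInf, Polynomial.leval]

theorem eventually_finrank_familyKer_le [FiniteDimensional k W] {ι : Type*} [Fintype ι]
    (φ : ι → W →ₗ[k] Polynomial k) (t₀ : k) :
    ∀ᶠ t in Filter.cofinite, Module.finrank k (familyKer φ t) ≤
      Module.finrank k (familyKer φ t₀) := by
  classical
  obtain ⟨C, hC⟩ := Submodule.exists_isCompl (familyKer φ t₀)
  let b := Module.finBasis k C
  let M (t : k) : C →ₗ[k] (ι → k) :=
    LinearMap.pi fun i => ((Polynomial.leval t).comp (φ i)).comp C.subtype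
  have hM : ∀ t (c : C), M t c = 0 ↔ (c : W) ∈ familyKer φ t := fun t c => by
    rw [mem_familyKer, funext_iff]
    rfl
  have hinj : LinearMap.ker (M t₀) = ⊥ := by
    rw [LinearMap.ker_eq_bot']
    intro c hc
    have := (Submodule.disjoint_def.1 hC.disjoint) c ((hM t₀ c).1 hc) c.2
    exact Subtype.ext this
  obtain ⟨g, hg⟩ := LinearMap.exists_leftInverse_of_injective _ hinj
  let A : Matrix (Fin (Module.finrank k C)) (Fin (Module.finrank k C)) (Polynomial k) :=
    Matrix.of fun i j => ∑ l, Polynomial.C (b.repr (g (Pi.single l 1)) i) * φ l (b j)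
  have hA : ∀ t, (A.det).eval t = LinearMap.det (g ∘ₗ M t) := fun t => by
    rw [← LinearMap.det_toMatrix b, ← Polynomial.coe_evalRingHom, RingHom.map_det]
    congr 1
    ext i j
    have : M t (b j) = ∑ l, (φ l (b j)).eval t • (Pi.single l 1 : ι → k) := by
      ext l
      simp [M, Polynomial.leval, Finset.sum_apply, Pi.single_apply]
    rw [LinearMap.toMatrix_apply, LinearMap.comp_apply, this]
    simp [A, RingHom.mapMatrix_apply, Matrix.map_apply, Polynomial.eval_finsetSum, mul_comm]
  have hA0 : A.det ≠ 0 := by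
    intro h
    have := hA t₀
    rw [h, hg] at this
    simp at this
  filter_upwards [Polynomial.eventually_eval_ne_zero hA0] with t ht
  rw [hA t] at ht
  have hdis : Disjoint (familyKer φ t) C := by
    rw [Submodule.disjoint_def]
    intro w hw hwC
    have h1 : (g ∘ₗ M t) ⟨w, hwC⟩ = 0 := by
      rw [LinearMap.comp_apply, (hM t ⟨w, hwC⟩).2 hw, map_zero]
    have h2 := LinearMap.bot_lt_ker_of_det_eq_zero (f := g ∘ₗ M t)
    have h3 := (LinearEquiv.ofIsUnitDet (f := g ∘ₗ M t) (v := b) (v' := b)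
      (by rw [LinearMap.det_toMatrix]; exact isUnit_iff_ne_zero.2 ht)).injective
    have h4 := h3 (a₁ := ⟨w, hwC⟩) (a₂ := 0) (by
      simpa using h1)
    simpa using congrArg Subtype.val h4
  have h1 := Submodule.finrank_add_finrank_le_of_disjoint hdis
  have h2 := Submodule.finrank_add_eq_of_isCompl hC
  omega

end Semicontinuity

section Configurations

open scoped Matrix

variable {k : Type*} [Field k]

theorem finrank_homogeneousSubmodule_fin_three (n : ℕ) :
    Module.finrank k (homogeneousSubmodule (Fin 3) k n) = (n + 2).choose 2 := by
  classical
  rw [homogeneousSubmodule_eq_finsupp_supported]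
  have h : {d : Fin 3 →₀ ℕ | d.degree = n} =
      ((univ : Finset (Fin 3)).finsuppAntidiag n : Set _) := by
    ext d
    simp [Finset.mem_finsuppAntidiag, Finsupp.degree_eq_sum]
  rw [h, (AddMonoidAlgebra.supportedEquivFinsupp (S := k) (R := k) _).finrank_eq,
    Module.finrank_finsupp_self]
  simp only [Finset.coe_sort_coe, Fintype.card_coe]
  rw [Finset.card_finsuppAntidiag_nat_eq_choose]
  · simp
    rw [add_comm 2 n, Nat.choose_symm_add]

instance homogeneousSubmodule_finite (n : ℕ) :
    FiniteDimensional k (homogeneousSubmodule (Fin 3) k n) :=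
  Module.finite_of_finrank_pos (by
    rw [finrank_homogeneousSubmodule_fin_three]
    exact Nat.choose_pos (by omega))

theorem eval_aeval_polynomial {σ : Type*} (P : σ → Polynomial k) (f : MvPolynomial σ k) (t : k) :
    (aeval P f : Polynomial k).eval t = eval (fun i => (P i).eval t) f := by
  induction f using MvPolynomial.induction_on with
  | C a => simp
  | add p q hp hq => simp [hp, hq]
  | mul_X p i hp => simp [hp]

variable {V : Type*}

/-- The forms of degree `n` vanishing at the intersection points `x a ∩ x b`, `(a, b) ∈ E`, of the
lines with coordinates `x`. -/
noncomputable def vanishing (E : Finset (V × V)) (x : V → Fin 3 → k) (n : ℕ) :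
    Submodule k (MvPolynomial (Fin 3) k) :=
  homogeneousSubmodule (Fin 3) k n ⊓
    ⨅ e : E, LinearMap.ker (aeval (R := k) (x e.1.1 ⨯₃ x e.1.2)).toLinearMap

theorem mem_vanishing {E : Finset (V × V)} {x : V → Fin 3 → k} {n : ℕ}
    {f : MvPolynomial (Fin 3) k} :
    f ∈ vanishing E x n ↔ f.IsHomogeneous n ∧ ∀ e ∈ E, eval (x e.1 ⨯₃ x e.2) f = 0 := by
  simp [vanishing, Submodule.mem_iInf, mem_homogeneousSubmodule, aeval_eq_eval]

instance vanishing_finite (E : Finset (V × V)) (x : V → Fin 3 → k) (n : ℕ) :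
    FiniteDimensional k (vanishing E x n) :=
  Submodule.finiteDimensional_of_le (S₂ := homogeneousSubmodule (Fin 3) k n) inf_le_left

theorem lineOpen_finrank_vanishing_le (E : Finset (V × V)) (n N : ℕ) :
    LineOpen k {x : V → Fin 3 → k | Module.finrank k (vanishing E x n) ≤ N} := by
  intro v hv w
  let L (a : V) : Fin 3 → Polynomial k := fun i =>
    Polynomial.C (v a i) + Polynomial.C (w a i) * Polynomial.X
  let φ (e : E) : homogeneousSubmodule (Fin 3) k n →ₗ[k] Polynomial k :=
    (aeval (L e.1.1 ⨯₃ L e.1.2)).toLinearMap ∘ₗ (homogeneousSubmodule (Fin 3) k n).subtype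
  have key : ∀ t, Module.finrank k (familyKer φ t) =
      Module.finrank k (vanishing E (v + t • w) n) := fun t => by
    rw [← Submodule.finrank_map_subtype_eq]
    have hL : ∀ e : E, (fun i => ((L e.1.1 ⨯₃ L e.1.2) i).eval t) =
        (v + t • w) e.1.1 ⨯₃ (v + t • w) e.1.2 := fun e => by
      ext i
      fin_cases i <;> simp [cross_apply, L] <;> ring
    suffices h : (familyKer φ t).map (homogeneousSubmodule (Fin 3) k n).subtype =
        vanishing E (v + t • w) n by rw [h]
    ext f
    simp only [Submodule.mem_map, Subtype.exists, mem_familyKer, mem_vanishing]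
    constructor
    · rintro ⟨a, ha, h, rfl⟩
      refine ⟨ha, fun e he => ?_⟩
      have := h ⟨e, he⟩
      simp only [φ, LinearMap.comp_apply, AlgHom.toLinearMap_apply, Submodule.subtype_apply] at this
      rw [eval_aeval_polynomial, hL ⟨e, he⟩] at this
      exact this
    · rintro ⟨ha, h⟩
      refine ⟨f, ha, fun e => ?_, rfl⟩
      simp only [φ, LinearMap.comp_apply, AlgHom.toLinearMap_apply, Submodule.subtype_apply]
      rw [eval_aeval_polynomial, hL]
      exact h e.1 e.2
  filter_upwards [eventually_finrank_familyKer_le φ 0] with t ht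
  rw [key, key, zero_smul, add_zero] at ht
  have : Module.finrank k (vanishing E v n) ≤ N := hv
  exact ht.trans this

/-- Some (hence the general) configuration of lines imposes enough conditions to leave at most an
`N`-dimensional space of forms of degree `n` through the points of `E`. -/
def GenBound (k : Type*) [Field k] {V : Type*} (E : Finset (V × V)) (n N : ℕ) : Prop :=
  ∃ x : V → Fin 3 → k, Module.finrank k (vanishing E x n) ≤ N

/-- No three of the lines `x a`, `a ∈ A`, are concurrent, and the line joining two intersection
points contains a third one only if it is forced to. -/
def IsGeneric (A : Finset V) (x : V → Fin 3 → k) : Prop :=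
  ∀ a ∈ A, ∀ b ∈ A, ∀ a' ∈ A, ∀ b' ∈ A, ∀ c ∈ A, ∀ d ∈ A,
    [a, b, a', b'].Nodup ∧ c ≠ d ∧ s(c, d) ≠ s(a, b) ∧ s(c, d) ≠ s(a', b') →
      (x c ⨯₃ x d) ⬝ᵥ ((x a ⨯₃ x b) ⨯₃ (x a' ⨯₃ x b')) ≠ 0

theorem exists_dot_ne_zero {a b a' b' c d : V}
    (h : [a, b, a', b'].Nodup ∧ c ≠ d ∧ s(c, d) ≠ s(a, b) ∧ s(c, d) ≠ s(a', b')) :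
    ∃ x : V → Fin 3 → k, (x c ⨯₃ x d) ⬝ᵥ ((x a ⨯₃ x b) ⨯₃ (x a' ⨯₃ x b')) ≠ 0 := by
  classical
  obtain ⟨h4, hcd, h1, h2⟩ := h
  simp only [List.nodup_cons, List.mem_cons, List.not_mem_nil, or_false, not_or,
    not_false_eq_true, List.nodup_nil, and_true] at h4
  obtain ⟨⟨hab, haa, hab'⟩, ⟨hba, hbb⟩, haab⟩ := h4
  let z := if c = a ∨ c = b ∨ c = a' ∨ c = b' then d else c
  let x : V → Fin 3 → k := fun v => if v = a then ![1, 0, 0] else if v = b then ![0, 1, 0] else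
    if v = a' then ![0, 0, 1] else if v = b' then ![1, 1, 1] else
    if v = z then ![1, 0, 1] else ![1, 0, 0]
  have xa : x a = ![1, 0, 0] := by simp [x]
  have xb : x b = ![0, 1, 0] := by simp [x, Ne.symm hab]
  have xa' : x a' = ![0, 0, 1] := by simp [x, Ne.symm haa, Ne.symm hba]
  have xb' : x b' = ![1, 1, 1] := by simp [x, Ne.symm hab', Ne.symm hbb, Ne.symm haab]
  refine ⟨x, ?_⟩
  rw [xa, xb, xa', xb']
  have hl : (![1, 0, 0] ⨯₃ ![0, 1, 0]) ⨯₃ (![0, 0, 1] ⨯₃ ![1, 1, 1]) =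
      (![-1, -1, 0] : Fin 3 → k) := by
    ext i
    fin_cases i <;> simp [cross_apply]
  rw [hl]
  by_cases hc : c = a ∨ c = b ∨ c = a' ∨ c = b'
  · by_cases hd : d = a ∨ d = b ∨ d = a' ∨ d = b'
    · rcases hc with rfl | rfl | rfl | rfl <;> rcases hd with rfl | rfl | rfl | rfl <;>
        first
        | exact absurd rfl hcd
        | exact absurd rfl h1
        | exact absurd rfl h2
        | exact absurd Sym2.eq_swap h1
        | exact absurd Sym2.eq_swap h2
        | simp [xa, xb, xa', xb', cross_apply, dotProduct, Fin.sum_univ_three]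
    · have xd : x d = ![1, 0, 1] := by
        have : z = d := if_pos hc
        simp only [not_or] at hd
        simp [x, this, hd]
      rcases hc with rfl | rfl | rfl | rfl <;>
        simp [xa, xb, xa', xb', xd, cross_apply, dotProduct, Fin.sum_univ_three]
  · have hz : z = c := if_neg hc
    simp only [not_or] at hc
    have xc : x c = ![1, 0, 1] := by simp [x, hz, hc]
    by_cases hd : d = a ∨ d = b ∨ d = a' ∨ d = b'
    · rcases hd with rfl | rfl | rfl | rfl <;>
        simp [xa, xb, xa', xb', xc, cross_apply, dotProduct, Fin.sum_univ_three]
    · have xd : x d = ![1, 0, 0] := by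
        simp only [not_or] at hd
        simp [x, hz, hd, hcd.symm]
      simp [xc, xd, cross_apply, dotProduct, Fin.sum_univ_three]

theorem polyOnLines_dot (a b a' b' c d : V) :
    PolyOnLines k fun x : V → Fin 3 → k =>
      (x c ⨯₃ x d) ⬝ᵥ ((x a ⨯₃ x b) ⨯₃ (x a' ⨯₃ x b')) := by
  have coord : ∀ v i, PolyOnLines k fun x : V → Fin 3 → k => x v i := fun v i =>
    .linear (LinearMap.proj (φ := fun _ : Fin 3 => k) i ∘ₗ
      LinearMap.proj (R := k) (φ := fun _ : V => Fin 3 → k) v)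
  have cross : ∀ {f g : (V → Fin 3 → k) → Fin 3 → k}, (∀ i, PolyOnLines k fun x => f x i) →
      (∀ i, PolyOnLines k fun x => g x i) → ∀ i, PolyOnLines k fun x => (f x ⨯₃ g x) i := by
    intro f g hf hg i
    fin_cases i <;> simp only [cross_apply] <;> exact ((hf _).mul (hg _)).sub ((hf _).mul (hg _))
  have h1 := cross (coord c) (coord d)
  have h2 := cross (cross (coord a) (coord b)) (cross (coord a') (coord b'))
  simp only [dotProduct, Fin.sum_univ_three]
  exact (((h1 _).mul (h2 _)).add ((h1 _).mul (h2 _))).add ((h1 _).mul (h2 _))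

theorem openDense_isGeneric [Infinite k] (A : Finset V) :
    OpenDense k {x : V → Fin 3 → k | IsGeneric A x} :=
  .forall_mem A fun a _ => .forall_mem A fun b _ => .forall_mem A fun a' _ =>
    .forall_mem A fun b' _ => .forall_mem A fun c _ => .forall_mem A fun d _ => .imp fun h =>
      ⟨(polyOnLines_dot a b a' b' c d).lineOpen, exists_dot_ne_zero h⟩

theorem GenBound.exists_isGeneric [Infinite k] {E : Finset (V × V)} {n N : ℕ}
    (h : GenBound k E n N) (A : Finset V) :
    ∃ x : V → Fin 3 → k, IsGeneric A x ∧ Module.finrank k (vanishing E x n) ≤ N :=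
  ((openDense_isGeneric A).inter ⟨lineOpen_finrank_vanishing_le E n N, h⟩).2

theorem IsGeneric.triple_ne_zero {A : Finset V} {x : V → Fin 3 → k} (h : IsGeneric A x)
    {a b c e : V} (ha : a ∈ A) (hb : b ∈ A) (hc : c ∈ A) (he : e ∈ A)
    (hn : [a, b, c, e].Nodup) : x a ⬝ᵥ (x b ⨯₃ x c) ≠ 0 := by
  intro h0
  have h4 := hn
  simp only [List.nodup_cons, List.mem_cons, List.not_mem_nil, or_false, not_or,
    not_false_eq_true, List.nodup_nil, and_true] at h4
  obtain ⟨⟨hab, hac, hae⟩, ⟨hbc, hbe⟩, hce⟩ := h4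
  refine h a ha b hb c hc e he c hc a ha ⟨hn, Ne.symm hac, ?_, ?_⟩ ?_
  · simp [Ne.symm hac, Ne.symm hbc]
  · simp [hac, hae]
  · have : (x c ⨯₃ x a) ⬝ᵥ ((x a ⨯₃ x b) ⨯₃ (x c ⨯₃ x e)) =
        (x a ⬝ᵥ (x b ⨯₃ x c)) * (-(x e ⬝ᵥ (x c ⨯₃ x a))) := by
      simp [cross_apply, dotProduct, Fin.sum_univ_three]
      ring
    rw [this, h0, zero_mul]

end Configurations

section Lines

open scoped Matrix

variable {k : Type*} [Field k]

/-- The linear form with coefficient vector `a`. -/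
noncomputable def lineForm (a : Fin 3 → k) : MvPolynomial (Fin 3) k :=
  ∑ i, C (a i) * X i

theorem eval_lineForm (a p : Fin 3 → k) : eval p (lineForm a) = a ⬝ᵥ p := by
  simp [lineForm, dotProduct]

theorem isHomogeneous_lineForm (a : Fin 3 → k) : (lineForm a).IsHomogeneous 1 :=
  IsHomogeneous.sum _ _ _ fun i _ => isHomogeneous_C_mul_X _ i

theorem lineForm_ne_zero {a : Fin 3 → k} (ha : a ≠ 0) : lineForm a ≠ 0 := by
  intro h
  apply ha
  ext i
  have := eval_lineForm a (Pi.single i 1)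
  rw [h, map_zero, dotProduct_single_one] at this
  exact this.symm

/-- Restriction of polynomials to the line through the origin and `p`. -/
noncomputable def restrictRay (p : Fin 3 → k) : MvPolynomial (Fin 3) k →ₐ[k] Polynomial k :=
  aeval fun i => Polynomial.C (p i) * Polynomial.X

theorem restrictRay_of_isHomogeneous {f : MvPolynomial (Fin 3) k} {n : ℕ} (hf : f.IsHomogeneous n)
    (p : Fin 3 → k) : restrictRay p f = Polynomial.C (eval p f) * Polynomial.X ^ n := by
  rw [restrictRay, aeval_def, eval₂_eq, eval_eq, map_sum, sum_mul]
  refine sum_congr rfl fun d hd => ?_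
  have h := hf.degree_eq_sum_deg_support hd
  simp only [mul_pow, prod_mul_distrib, prod_pow_eq_pow_sum, map_mul, map_prod, map_pow,
    ← mul_assoc]
  rw [h]
  rfl

theorem restrictRay_lineForm (a p : Fin 3 → k) :
    restrictRay p (lineForm a) = Polynomial.C (a ⬝ᵥ p) * Polynomial.X := by
  simpa [eval_lineForm] using restrictRay_of_isHomogeneous (isHomogeneous_lineForm a) p

theorem aeval_sub_aeval_mem {σ R : Type*} [CommRing R] [Algebra k R] (I : Ideal R) {P Q : σ → R}
    (h : ∀ i, P i - Q i ∈ I) (f : MvPolynomial σ k) : aeval P f - aeval Q f ∈ I := by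
  induction f using MvPolynomial.induction_on with
  | C a => simp
  | add p q hp hq =>
    have : aeval P (p + q) - aeval Q (p + q) =
        (aeval P p - aeval Q p) + (aeval P q - aeval Q q) := by
      simp only [map_add]
      ring
    rw [this]
    exact I.add_mem hp hq
  | mul_X p i hp =>
    have : aeval P (p * X i) - aeval Q (p * X i) =
        P i * (aeval P p - aeval Q p) + aeval Q p * (P i - Q i) := by
      simp only [map_mul, aeval_X]
      ring
    rw [this]
    exact I.add_mem (I.mul_mem_left _ hp) (I.mul_mem_left _ (h i))

theorem mem_span_pair_of_restrictRay_eq_zero {a b : Fin 3 → k} (hab : a ⨯₃ b ≠ 0)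
    {f : MvPolynomial (Fin 3) k} (hf : restrictRay (a ⨯₃ b) f = 0) :
    f ∈ Ideal.span {lineForm a, lineForm b} := by
  obtain ⟨j, hj⟩ := Function.ne_iff.1 hab
  obtain ⟨c, hc⟩ : ∃ c : Fin 3 → k, c ⬝ᵥ (a ⨯₃ b) = 1 :=
    ⟨Pi.single j ((a ⨯₃ b) j)⁻¹, by rw [single_dotProduct]; exact inv_mul_cancel₀ hj⟩
  have h0 : aeval (fun i => C ((a ⨯₃ b) i) * lineForm c) f = 0 := by
    have : aeval (fun i => C ((a ⨯₃ b) i) * lineForm c) f =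
        Polynomial.aeval (lineForm c) (restrictRay (a ⨯₃ b) f) := by
      rw [restrictRay, ← AlgHom.comp_apply]
      congr 1
      ext i : 1
      simp [MvPolynomial.algebraMap_eq]
    rw [this, hf, map_zero]
  have h1 := aeval_sub_aeval_mem (Ideal.span {lineForm a, lineForm b})
    (P := X) (Q := fun i => C ((a ⨯₃ b) i) * lineForm c) (fun i => by
      rw [Ideal.mem_span_pair]
      refine ⟨-C ((c ⨯₃ b) i), C ((c ⨯₃ a) i), ?_⟩
      have hX : (X i : MvPolynomial (Fin 3) k) = C (c ⬝ᵥ (a ⨯₃ b)) * X i := by simp [hc]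
      rw [hX]
      fin_cases i <;>
      · simp [lineForm, dotProduct, Fin.sum_univ_three, cross_apply]
        ring) f
  rw [h0, aeval_X_left] at h1
  simpa using h1

theorem mem_span_lineForm_prod {ι : Type*} (T : Finset ι) (y : ι → Fin 3 → k) {a : Fin 3 → k}
    (h0 : ∀ c ∈ T, a ⨯₃ y c ≠ 0) (h1 : ∀ c ∈ T, ∀ c' ∈ T, c ≠ c' → y c' ⬝ᵥ (a ⨯₃ y c) ≠ 0)
    {f : MvPolynomial (Fin 3) k} (hf : ∀ c ∈ T, restrictRay (a ⨯₃ y c) f = 0) :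
    f ∈ Ideal.span {lineForm a, ∏ c ∈ T, lineForm (y c)} := by
  classical
  induction T using Finset.induction_on with
  | empty => simp [Ideal.span_insert]
  | insert c T hc ih =>
    have h := ih (fun c hc => h0 c (mem_insert_of_mem hc))
      (fun c hc c' hc' => h1 c (mem_insert_of_mem hc) c' (mem_insert_of_mem hc'))
      (fun c hc => hf c (mem_insert_of_mem hc))
    obtain ⟨α, β, rfl⟩ := Ideal.mem_span_pair.1 h
    have h2 := hf c (mem_insert_self c T)
    rw [map_add, map_mul, map_mul, restrictRay_lineForm, dot_self_cross, map_zero, zero_mul,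
      mul_zero, zero_add, map_prod] at h2
    have h3 : ∏ c' ∈ T, restrictRay (a ⨯₃ y c) (lineForm (y c')) ≠ 0 := by
      refine prod_ne_zero_iff.2 fun c' hc' => ?_
      rw [restrictRay_lineForm]
      have := h1 c (mem_insert_self c T) c' (mem_insert_of_mem hc') (by rintro rfl; exact hc hc')
      simpa using this
    have h4 := mem_span_pair_of_restrictRay_eq_zero (h0 c (mem_insert_self c T))
      ((mul_eq_zero.1 h2).resolve_right h3)
    obtain ⟨γ, δ, rfl⟩ := Ideal.mem_span_pair.1 h4
    rw [Ideal.mem_span_pair, prod_insert hc]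
    exact ⟨α + γ * ∏ c ∈ T, lineForm (y c), δ, by ring⟩

theorem mem_span_prod_prod {ι : Type*} [DecidableEq ι] (S T : Finset ι) (y : ι → Fin 3 → k)
    (h0 : ∀ a ∈ S, ∀ b ∈ T, y a ⨯₃ y b ≠ 0)
    (h1 : ∀ a ∈ S, ∀ b ∈ T, ∀ b' ∈ T, b ≠ b' → y b' ⬝ᵥ (y a ⨯₃ y b) ≠ 0)
    (h2 : ∀ a ∈ S, ∀ a' ∈ S, ∀ b ∈ T, a ≠ a' → y a' ⬝ᵥ (y a ⨯₃ y b) ≠ 0)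
    {f : MvPolynomial (Fin 3) k} (hf : ∀ a ∈ S, ∀ b ∈ T, restrictRay (y a ⨯₃ y b) f = 0) :
    f ∈ Ideal.span {∏ a ∈ S, lineForm (y a), ∏ b ∈ T, lineForm (y b)} := by
  induction S using Finset.induction_on generalizing f with
  | empty => simp [Ideal.span_insert]
  | insert a S ha ih =>
    have h := mem_span_lineForm_prod T y (h0 a (mem_insert_self a S)) (h1 a (mem_insert_self a S))
      (hf a (mem_insert_self a S))
    obtain ⟨α, β, rfl⟩ := Ideal.mem_span_pair.1 h
    have hα : α ∈ Ideal.span {∏ a ∈ S, lineForm (y a), ∏ b ∈ T, lineForm (y b)} := by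
      refine ih (fun c hc => h0 c (mem_insert_of_mem hc)) (fun c hc => h1 c (mem_insert_of_mem hc))
        (fun c hc c' hc' => h2 c (mem_insert_of_mem hc) c' (mem_insert_of_mem hc'))
        (fun c hc b hb => ?_)
      have h3 := hf c (mem_insert_of_mem hc) b hb
      have h4 : ∏ b' ∈ T, restrictRay (y c ⨯₃ y b) (lineForm (y b')) = 0 :=
        prod_eq_zero hb (by rw [restrictRay_lineForm, dot_cross_self]; simp)
      rw [map_add, map_mul, map_mul, map_prod, h4, mul_zero, add_zero] at h3
      refine (mul_eq_zero.1 h3).resolve_right ?_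
      rw [restrictRay_lineForm]
      have := h2 c (mem_insert_of_mem hc) a (mem_insert_self a S) b hb (by rintro rfl; exact ha hc)
      simpa using this
    obtain ⟨γ, δ, rfl⟩ := Ideal.mem_span_pair.1 hα
    rw [Ideal.mem_span_pair, prod_insert ha]
    exact ⟨γ, δ * lineForm (y a) + β, by ring⟩

theorem homogeneousComponent_add_mul {σ : Type*} {φ : MvPolynomial σ k} {m : ℕ}
    (hφ : φ.IsHomogeneous m) (n : ℕ) (ψ : MvPolynomial σ k) :
    homogeneousComponent (m + n) (φ * ψ) = φ * homogeneousComponent n ψ := by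
  let _ := MvPolynomial.gradedAlgebra (σ := σ) (R := k)
  have h := DirectSum.coe_decompose_mul_add_of_left_mem (homogeneousSubmodule σ k)
    (i := m) (j := n) (b := ψ) hφ
  rw [← decomposition.decompose'_apply, ← decomposition.decompose'_apply]
  exact h

theorem exists_eq_lineForm_mul [Infinite k] {a : Fin 3 → k} (ha : a ≠ 0)
    {f : MvPolynomial (Fin 3) k} {n : ℕ} (hf : f.IsHomogeneous (n + 1))
    (h : ∀ p : Fin 3 → k, a ⬝ᵥ p = 0 → eval p f = 0) :
    ∃ g : MvPolynomial (Fin 3) k, g.IsHomogeneous n ∧ f = lineForm a * g := by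
  obtain ⟨j, hj⟩ := Function.ne_iff.1 ha
  obtain ⟨v, hv⟩ : ∃ v : Fin 3 → k, a ⬝ᵥ v = 1 :=
    ⟨Pi.single j (a j)⁻¹, by rw [dotProduct_single]; exact mul_inv_cancel₀ hj⟩
  have h1 := aeval_sub_aeval_mem (Ideal.span {lineForm a})
    (P := X) (Q := fun i => X i - lineForm a * C (v i)) (fun i => by
      rw [sub_sub_cancel]
      exact Ideal.mul_mem_right _ _ (Ideal.mem_span_singleton_self _)) f
  have h2 : aeval (fun i => X i - lineForm a * C (v i)) f = 0 := by
    refine MvPolynomial.funext fun p => ?_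
    have : eval p (aeval (fun i => X i - lineForm a * C (v i)) f) = eval (p - (a ⬝ᵥ p) • v) f := by
      rw [← coe_aeval_eq_eval p, RingHom.coe_coe, ← AlgHom.comp_apply, ← coe_aeval_eq_eval,
        RingHom.coe_coe]
      congr 1
      ext i : 1
      simp [aeval_eq_eval, eval_lineForm]
    rw [this, map_zero]
    apply h
    rw [dotProduct_sub, dotProduct_smul, hv]
    simp
  rw [h2, aeval_X_left, sub_zero, AlgHom.coe_id, id, Ideal.mem_span_singleton] at h1
  obtain ⟨g, hg⟩ := h1
  refine ⟨homogeneousComponent n g, homogeneousComponent_isHomogeneous n g, ?_⟩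
  rw [← homogeneousComponent_add_mul (isHomogeneous_lineForm a), ← hg, add_comm 1 n,
    homogeneousComponent_eq_self hf]

theorem eval_eq_zero_of_card_lt {ι : Type*} [DecidableEq ι] (T : Finset ι) (y : ι → Fin 3 → k)
    {a : Fin 3 → k} (h0 : ∀ c ∈ T, a ⨯₃ y c ≠ 0)
    (h1 : ∀ c ∈ T, ∀ c' ∈ T, c ≠ c' → y c' ⬝ᵥ (a ⨯₃ y c) ≠ 0)
    {f : MvPolynomial (Fin 3) k} {n : ℕ} (hf : f.IsHomogeneous n) (hn : n < #T)
    (hv : ∀ c ∈ T, eval (a ⨯₃ y c) f = 0) (p : Fin 3 → k) (hp : a ⬝ᵥ p = 0) : eval p f = 0 := by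
  have h := mem_span_lineForm_prod T y h0 h1 (fun c hc => by
    rw [restrictRay_of_isHomogeneous hf, hv c hc, map_zero, zero_mul])
  obtain ⟨α, β, hαβ⟩ := Ideal.mem_span_pair.1 h
  have h2 := congrArg (restrictRay p) hαβ
  rw [map_add, map_mul, map_mul, restrictRay_lineForm, hp, map_zero, zero_mul, mul_zero, zero_add,
    restrictRay_of_isHomogeneous hf, restrictRay_of_isHomogeneous
      (IsHomogeneous.prod T _ _ fun c _ => isHomogeneous_lineForm (y c)), ← mul_assoc] at h2
  have h3 := congrArg (fun P => P.coeff n) h2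
  simp only [Polynomial.coeff_C_mul_X_pow, if_true] at h3
  rw [← h3, Polynomial.coeff_mul_X_pow', if_neg]
  simpa using hn

end Lines

section Degeneration

open scoped Matrix

variable {k : Type*} [Field k]

theorem finrank_le_card_add {M : Type*} [AddCommGroup M] [Module k M] (Q : Submodule k M)
    [FiniteDimensional k Q] {ι : Type*} [Fintype ι] (ψ : ι → M →ₗ[k] k) :
    Module.finrank k Q ≤
      Fintype.card ι + Module.finrank k (Q ⊓ ⨅ i, LinearMap.ker (ψ i) : Submodule k M) := by
  let g : Q →ₗ[k] (ι → k) := LinearMap.pi fun i => ψ i ∘ₗ Q.subtype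
  have h1 := LinearMap.finrank_range_add_finrank_ker g
  have h2 : Module.finrank k (LinearMap.range g) ≤ Fintype.card ι := by
    simpa using Submodule.finrank_le (LinearMap.range g)
  have h3 : (LinearMap.ker g).map Q.subtype = Q ⊓ ⨅ i, LinearMap.ker (ψ i) := by
    ext f
    simp only [Submodule.mem_map, LinearMap.mem_ker, Submodule.mem_inf, Submodule.mem_iInf,
      Subtype.exists, g, funext_iff]
    constructor
    · rintro ⟨a, ha, h, rfl⟩
      exact ⟨ha, h⟩
    · rintro ⟨ha, h⟩
      exact ⟨f, ha, h, rfl⟩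
  rw [← h3, Submodule.finrank_map_subtype_eq]
  omega

theorem choose_le_card_add_finrank_vanishing {V : Type*} (E : Finset (V × V))
    (x : V → Fin 3 → k) (n : ℕ) :
    (n + 2).choose 2 ≤ #E + Module.finrank k (vanishing E x n) := by
  have h := finrank_le_card_add (homogeneousSubmodule (Fin 3) k n)
    fun e : E => (aeval (R := k) (x e.1.1 ⨯₃ x e.1.2)).toLinearMap
  rwa [finrank_homogeneousSubmodule_fin_three, Fintype.card_coe] at h

theorem eval_smul_of_isHomogeneous {f : MvPolynomial (Fin 3) k} {n : ℕ} (hf : f.IsHomogeneous n)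
    (c : k) (p : Fin 3 → k) : eval (c • p) f = c ^ n * eval p f := by
  have h := restrictRay_of_isHomogeneous hf p
  have h2 := congrArg (Polynomial.eval c) h
  rw [restrictRay, eval_aeval_polynomial] at h2
  simp only [Polynomial.eval_mul, Polynomial.eval_C, Polynomial.eval_X, Polynomial.eval_pow] at h2
  rw [mul_comm, ← h2]
  congr 2
  ext i
  simp [mul_comm]

theorem eval_smul_eq_zero_iff {f : MvPolynomial (Fin 3) k} {n : ℕ} (hf : f.IsHomogeneous n)
    {c : k} (hc : c ≠ 0) (p : Fin 3 → k) : eval (c • p) f = 0 ↔ eval p f = 0 := by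
  rw [eval_smul_of_isHomogeneous hf, mul_eq_zero, or_iff_right (pow_ne_zero _ hc)]

/-- Restriction of polynomials to the affine line through `p` with direction `v`. -/
noncomputable def restrictLine (p v : Fin 3 → k) : MvPolynomial (Fin 3) k →ₐ[k] Polynomial k :=
  aeval fun i => Polynomial.C (p i) + Polynomial.C (v i) * Polynomial.X

theorem eval_restrictLine (p v : Fin 3 → k) (f : MvPolynomial (Fin 3) k) (t : k) :
    (restrictLine p v f).eval t = eval (p + t • v) f := by
  rw [restrictLine, eval_aeval_polynomial]
  congr 2
  ext i
  simp [mul_comm t]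

theorem restrictLine_lineForm (a p v : Fin 3 → k) : restrictLine p v (lineForm a) =
    Polynomial.C (a ⬝ᵥ p) + Polynomial.C (a ⬝ᵥ v) * Polynomial.X := by
  simp only [restrictLine, lineForm, dotProduct, Fin.sum_univ_three, map_add, map_mul, aeval_C,
    aeval_X, Polynomial.algebraMap_eq]
  ring

/-- `Polynomial.divX` as a linear map. -/
noncomputable def divXLinear (k : Type*) [Field k] : Polynomial k →ₗ[k] Polynomial k where
  toFun := Polynomial.divX
  map_add' _ _ := Polynomial.divX_add
  map_smul' c P := by simp [Polynomial.smul_eq_C_mul, Polynomial.divX_C_mul]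

/-- The family of functionals along the degeneration of the line `u` to `l` in the direction `m`,
divided by the parameter at the marked vertices. -/
noncomputable def horaceFunctional (P : Prop) [Decidable P] (p v : Fin 3 → k) :
    MvPolynomial (Fin 3) k →ₗ[k] Polynomial k :=
  if P then divXLinear k ∘ₗ (restrictLine p v).toLinearMap else (restrictLine p v).toLinearMap

theorem horaceFunctional_of_not {P : Prop} [Decidable P] (hP : ¬ P) (p v : Fin 3 → k)
    (f : MvPolynomial (Fin 3) k) : horaceFunctional P p v f = restrictLine p v f := by
  simp [horaceFunctional, hP]

theorem X_mul_horaceFunctional {P : Prop} [Decidable P] (hP : P) (p v : Fin 3 → k)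
    {f : MvPolynomial (Fin 3) k} (hf : eval p f = 0) :
    Polynomial.X * horaceFunctional P p v f = restrictLine p v f := by
  have h := Polynomial.X_mul_divX_add (restrictLine p v f)
  rw [Polynomial.coeff_zero_eq_eval_zero, eval_restrictLine, zero_smul, add_zero, hf, map_zero,
    add_zero] at h
  rw [horaceFunctional, if_pos hP]
  exact h

/-- Forms of degree `n` vanishing on `E` and on the points `l ∩ x c`, `c ∈ W`. -/
noncomputable def baseForms {V : Type*} (E : Finset (V × V)) (W : Finset V) (x : V → Fin 3 → k)
    (l : Fin 3 → k) (n : ℕ) : Submodule k (MvPolynomial (Fin 3) k) :=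
  vanishing E x n ⊓ ⨅ c : W, LinearMap.ker (aeval (R := k) (l ⨯₃ x c)).toLinearMap

theorem mem_baseForms {V : Type*} {E : Finset (V × V)} {W : Finset V} {x : V → Fin 3 → k}
    {l : Fin 3 → k} {n : ℕ} {f : MvPolynomial (Fin 3) k} :
    f ∈ baseForms E W x l n ↔ (f.IsHomogeneous n ∧ ∀ e ∈ E, eval (x e.1 ⨯₃ x e.2) f = 0) ∧
      ∀ c ∈ W, eval (l ⨯₃ x c) f = 0 := by
  simp [baseForms, Submodule.mem_iInf, mem_vanishing, aeval_eq_eval]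

/-- The limit of the spaces of forms along the degeneration. -/
noncomputable def limitForms {V : Type*} [DecidableEq V] (E : Finset (V × V)) (U W M : Finset V)
    (x : V → Fin 3 → k) (l m : Fin 3 → k) (n : ℕ) : Submodule k (MvPolynomial (Fin 3) k) :=
  baseForms E W x l n ⊓ ⨅ c : U, LinearMap.ker
    (Polynomial.leval 0 ∘ₗ horaceFunctional (c.1 ∈ M) (l ⨯₃ x c) (m ⨯₃ x c))

theorem mem_limitForms {V : Type*} [DecidableEq V] {E : Finset (V × V)} {U W M : Finset V}
    {x : V → Fin 3 → k} {l m : Fin 3 → k} {n : ℕ} {f : MvPolynomial (Fin 3) k} :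
    f ∈ limitForms E U W M x l m n ↔ f ∈ baseForms E W x l n ∧
      ∀ c ∈ U, (horaceFunctional (c ∈ M) (l ⨯₃ x c) (m ⨯₃ x c) f).eval 0 = 0 := by
  simp [limitForms, Submodule.mem_iInf, Polynomial.leval]

theorem genBound_limitForms [Infinite k] {V : Type*} [DecidableEq V] {E E' : Finset (V × V)}
    {U W M : Finset V} {u w : V} (huw : u ≠ w) (huU : u ∉ U) (hwU : w ∉ U) (huW : u ∉ W)
    (hwW : w ∉ W) (hEU : ∀ c ∈ U, (u, c) ∈ E) (hEW : ∀ c ∈ W, (w, c) ∈ E)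
    (hE' : ∀ e ∈ E', e ∈ E ∧ e.1 ≠ u ∧ e.1 ≠ w ∧ e.2 ≠ u ∧ e.2 ≠ w)
    (x : V → Fin 3 → k) (l m : Fin 3 → k) (n : ℕ)
    (hM : ∀ f ∈ baseForms E' W x l n, ∀ c ∈ U, c ∈ M → eval (l ⨯₃ x c) f = 0) :
    GenBound k E n (Module.finrank k (limitForms E' U W M x l m n)) := by
  let y (t : k) : V → Fin 3 → k := fun v => if v = u then l + t • m else if v = w then l else x v
  have yu : ∀ t, y t u = l + t • m := fun t => if_pos rfl
  have yw : ∀ t, y t w = l := fun t => by simp [y, huw.symm]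
  have yx : ∀ t v, v ≠ u → v ≠ w → y t v = x v := fun t v h1 h2 => by simp [y, h1, h2]
  have : FiniteDimensional k (baseForms E' W x l n) := Submodule.finiteDimensional_of_le
    (S₂ := vanishing E' x n) inf_le_left
  let φ (c : U) : baseForms E' W x l n →ₗ[k] Polynomial k :=
    horaceFunctional (c.1 ∈ M) (l ⨯₃ x c) (m ⨯₃ x c) ∘ₗ (baseForms E' W x l n).subtype
  have hφ0 : (familyKer φ 0).map (baseForms E' W x l n).subtype =
      limitForms E' U W M x l m n := by
    ext f
    simp only [Submodule.mem_map, Subtype.exists, mem_familyKer, mem_limitForms]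
    constructor
    · rintro ⟨a, ha, h, rfl⟩
      exact ⟨ha, fun c hc => h ⟨c, hc⟩⟩
    · rintro ⟨ha, h⟩
      exact ⟨f, ha, fun c => h c.1 c.2, rfl⟩
  have hφt : ∀ t, t ≠ 0 → vanishing E (y t) n ≤
      (familyKer φ t).map (baseForms E' W x l n).subtype := by
    intro t ht f hf
    rw [mem_vanishing] at hf
    have hbase : f ∈ baseForms E' W x l n := by
      refine mem_baseForms.2 ⟨⟨hf.1, fun e he => ?_⟩, fun c hc => ?_⟩
      · obtain ⟨h1, h2, h3, h4, h5⟩ := hE' e he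
        have := hf.2 e h1
        rwa [yx t _ h2 h3, yx t _ h4 h5] at this
      · have := hf.2 _ (hEW c hc)
        rwa [yw, yx t c (by rintro rfl; exact huW hc) (by rintro rfl; exact hwW hc)] at this
    refine Submodule.mem_map.2 ⟨⟨f, hbase⟩, mem_familyKer.2 fun c => ?_, rfl⟩
    have h0 := hf.2 _ (hEU c.1 c.2)
    rw [yu, yx t c.1 (fun h => huU (h ▸ c.2)) (fun h => hwU (h ▸ c.2)), map_add,
      LinearMap.add_apply, map_smul, LinearMap.smul_apply, ← eval_restrictLine] at h0
    change (horaceFunctional (c.1 ∈ M) (l ⨯₃ x c) (m ⨯₃ x c) f).eval t = 0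
    by_cases hcM : c.1 ∈ M
    · rw [← X_mul_horaceFunctional hcM _ _ (hM f hbase c.1 c.2 hcM), Polynomial.eval_mul,
        Polynomial.eval_X] at h0
      exact (mul_eq_zero.1 h0).resolve_left ht
    · rwa [horaceFunctional_of_not hcM]
  obtain ⟨t, ht, ht0⟩ := ((eventually_finrank_familyKer_le φ 0).and
    (Filter.eventually_cofinite_ne 0)).exists
  refine ⟨y t, (Submodule.finrank_mono (hφt t ht0)).trans ?_⟩
  rw [Submodule.finrank_map_subtype_eq, ← hφ0, Submodule.finrank_map_subtype_eq]
  exact ht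

theorem finrank_limitForms_le [Infinite k] {V : Type*} [DecidableEq V] {E E' : Finset (V × V)}
    {U W M S F : Finset V} {x : V → Fin 3 → k} {l m : Fin 3 → k} {n : ℕ} (hl : l ≠ 0)
    (hE' : ∀ e ∈ E', l ⬝ᵥ (x e.1 ⨯₃ x e.2) ≠ 0)
    (hE : ∀ e ∈ E, e ∈ E' ∨ ∃ c ∈ U, c ∈ M ∧ l ⬝ᵥ (m ⨯₃ x c) ≠ 0 ∧
      ∃ r : k, r ≠ 0 ∧ l ⨯₃ x c = r • (x e.1 ⨯₃ x e.2))
    (hS : S ⊆ (U \ M) ∪ W) (hSF : n + 1 < #(S ∪ F))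
    (hT0 : ∀ c ∈ S ∪ F, l ⨯₃ x c ≠ 0)
    (hT1 : ∀ c ∈ S ∪ F, ∀ c' ∈ S ∪ F, c ≠ c' → x c' ⬝ᵥ (l ⨯₃ x c) ≠ 0) :
    Module.finrank k (limitForms E' U W M x l m (n + 1)) ≤
      #F + Module.finrank k (vanishing E x n) := by
  have : FiniteDimensional k (limitForms E' U W M x l m (n + 1)) :=
    Submodule.finiteDimensional_of_le (S₂ := vanishing E' x (n + 1))
      (inf_le_left.trans inf_le_left)
  have h1 := finrank_le_card_add (limitForms E' U W M x l m (n + 1))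
    fun c : F => (aeval (R := k) (l ⨯₃ x c.1)).toLinearMap
  rw [Fintype.card_coe] at h1
  refine h1.trans (Nat.add_le_add_left ?_ _)
  refine le_trans (Submodule.finrank_mono ?_)
    (Submodule.finrank_map_le (LinearMap.mulLeft k (lineForm l)) (vanishing E x n))
  intro f hf
  simp only [Submodule.mem_inf, Submodule.mem_iInf, mem_limitForms, mem_baseForms,
    LinearMap.mem_ker, AlgHom.toLinearMap_apply, aeval_eq_eval, Subtype.forall] at hf
  obtain ⟨⟨⟨⟨hf0, hf1⟩, hf2⟩, hf3⟩, hf4⟩ := hf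
  have hv : ∀ c ∈ S ∪ F, eval (l ⨯₃ x c) f = 0 := by
    intro c hc
    rcases mem_union.1 hc with hc | hc
    · rcases mem_union.1 (hS hc) with hc | hc
      · rw [mem_sdiff] at hc
        have := hf3 c hc.1
        rwa [horaceFunctional_of_not hc.2, eval_restrictLine, zero_smul, add_zero] at this
      · exact hf2 c hc
    · exact hf4 c hc
  obtain ⟨g, hg, rfl⟩ := exists_eq_lineForm_mul hl hf0
    (eval_eq_zero_of_card_lt (S ∪ F) x hT0 hT1 hf0 hSF hv)
  refine Submodule.mem_map.2 ⟨g, mem_vanishing.2 ⟨hg, fun e he => ?_⟩, rfl⟩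
  rcases hE e he with he | ⟨c, hcU, hcM, hlm, r, hr, hlc⟩
  · have := hf1 e he
    rw [map_mul, eval_lineForm] at this
    exact (mul_eq_zero.1 this).resolve_left (hE' e he)
  · have h2 := X_mul_horaceFunctional hcM (l ⨯₃ x c) (m ⨯₃ x c) (f := lineForm l * g)
      (by rw [map_mul, eval_lineForm, dot_self_cross, zero_mul])
    rw [map_mul (restrictLine _ _), restrictLine_lineForm, dot_self_cross, map_zero, zero_add,
      mul_comm (Polynomial.C _), mul_assoc] at h2
    have h3 := hf3 c hcU
    rw [mul_left_cancel₀ Polynomial.X_ne_zero h2, Polynomial.eval_mul, Polynomial.eval_C,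
      eval_restrictLine, zero_smul, add_zero, hlc] at h3
    exact (eval_smul_eq_zero_iff hg hr _).1 ((mul_eq_zero.1 h3).resolve_left hlm)

end Degeneration

section Move

open scoped Matrix

variable {k : Type*} [Field k]

theorem cross_cross_left_self (a b q : Fin 3 → k) :
    ((a ⨯₃ b) ⨯₃ q) ⨯₃ a = (-(a ⬝ᵥ q)) • (a ⨯₃ b) := by
  ext i
  fin_cases i <;> simp [cross_apply, dotProduct, Fin.sum_univ_three] <;> ring

theorem cross_cross_right_self (a b q : Fin 3 → k) :
    (q ⨯₃ (a ⨯₃ b)) ⨯₃ a = (a ⬝ᵥ q) • (a ⨯₃ b) := by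
  ext i
  fin_cases i <;> simp [cross_apply, dotProduct, Fin.sum_univ_three] <;> ring

theorem cross_cross_left_other (a b q : Fin 3 → k) :
    ((a ⨯₃ b) ⨯₃ q) ⨯₃ b = (-(b ⬝ᵥ q)) • (a ⨯₃ b) := by
  ext i
  fin_cases i <;> simp [cross_apply, dotProduct, Fin.sum_univ_three] <;> ring

theorem cross_cross_right_other (a b q : Fin 3 → k) :
    (q ⨯₃ (a ⨯₃ b)) ⨯₃ b = (b ⬝ᵥ q) • (a ⨯₃ b) := by
  ext i
  fin_cases i <;> simp [cross_apply, dotProduct, Fin.sum_univ_three] <;> ring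

theorem dotProduct_cross_swap (l a c : Fin 3 → k) : c ⬝ᵥ (l ⨯₃ a) = l ⬝ᵥ (a ⨯₃ c) := by
  simp [cross_apply, dotProduct, Fin.sum_univ_three]
  ring

variable {V : Type*}

theorem IsGeneric.mono {A B : Finset V} {x : V → Fin 3 → k} (h : IsGeneric B x) (hAB : A ⊆ B) :
    IsGeneric A x := by
  intro a ha b hb a' ha' b' hb' c hc d hd
  exact h a (hAB ha) b (hAB hb) a' (hAB ha') b' (hAB hb') c (hAB hc) d (hAB hd)

/-- Two pairs of lines, whose intersection points span the limit line of a degeneration. -/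
structure IsCollision (a₁ b₁ a₂ b₂ : V) (A : Finset V) : Prop where
  nodup : [a₁, b₁, a₂, b₂].Nodup
  mem₁ : a₁ ∈ A
  mem₁' : b₁ ∈ A
  mem₂ : a₂ ∈ A
  mem₂' : b₂ ∈ A

theorem IsGeneric.limit_ne {A : Finset V} {x : V → Fin 3 → k} (hx : IsGeneric A x)
    {a₁ b₁ a₂ b₂ : V} (h : IsCollision a₁ b₁ a₂ b₂ A) {c d : V} (hc : c ∈ A) (hd : d ∈ A)
    (hcd : c ≠ d) (h1 : s(c, d) ≠ s(a₁, b₁)) (h2 : s(c, d) ≠ s(a₂, b₂)) :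
    ((x a₁ ⨯₃ x b₁) ⨯₃ (x a₂ ⨯₃ x b₂)) ⬝ᵥ (x c ⨯₃ x d) ≠ 0 := by
  rw [dotProduct_comm]
  exact hx a₁ h.mem₁ b₁ h.mem₁' a₂ h.mem₂ b₂ h.mem₂' c hc d hd ⟨h.nodup, hcd, h1, h2⟩

theorem IsCollision.cross_left {A : Finset V} {x : V → Fin 3 → k} (hx : IsGeneric A x)
    {a₁ b₁ a₂ b₂ : V} (h : IsCollision a₁ b₁ a₂ b₂ A) {c : V} (hc : c = a₁ ∨ c = b₁) :
    ∃ r : k, r ≠ 0 ∧ ((x a₁ ⨯₃ x b₁) ⨯₃ (x a₂ ⨯₃ x b₂)) ⨯₃ x c = r • (x a₁ ⨯₃ x b₁) := by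
  obtain ⟨hn, h1, h2, h3, h4⟩ := h
  rcases hc with rfl | rfl
  · exact ⟨_, neg_ne_zero.2 (hx.triple_ne_zero h1 h3 h4 h2 (by grind)),
      cross_cross_left_self _ _ _⟩
  · exact ⟨_, neg_ne_zero.2 (hx.triple_ne_zero h2 h3 h4 h1 (by grind)),
      cross_cross_left_other _ _ _⟩

theorem IsCollision.cross_right {A : Finset V} {x : V → Fin 3 → k} (hx : IsGeneric A x)
    {a₁ b₁ a₂ b₂ : V} (h : IsCollision a₁ b₁ a₂ b₂ A) {c : V} (hc : c = a₂ ∨ c = b₂) :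
    ∃ r : k, r ≠ 0 ∧ ((x a₁ ⨯₃ x b₁) ⨯₃ (x a₂ ⨯₃ x b₂)) ⨯₃ x c = r • (x a₂ ⨯₃ x b₂) := by
  obtain ⟨hn, h1, h2, h3, h4⟩ := h
  rcases hc with rfl | rfl
  · exact ⟨_, hx.triple_ne_zero h3 h1 h2 h4 (by grind), cross_cross_right_self _ _ _⟩
  · exact ⟨_, hx.triple_ne_zero h4 h1 h2 h3 (by grind), cross_cross_right_other _ _ _⟩

theorem IsCollision.dot_cross_add_ne_zero {A : Finset V} {x : V → Fin 3 → k}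
    (hx : IsGeneric A x) {a₁ b₁ a₂ b₂ : V} (h : IsCollision a₁ b₁ a₂ b₂ A) {c : V}
    (hc : c = a₁ ∨ c = a₂) :
    ((x a₁ ⨯₃ x b₁) ⨯₃ (x a₂ ⨯₃ x b₂)) ⬝ᵥ ((x a₁ + x a₂) ⨯₃ x c) ≠ 0 := by
  have hn := h.nodup
  rw [map_add, LinearMap.add_apply]
  rcases hc with rfl | rfl
  · rw [cross_self, zero_add]
    exact hx.limit_ne h h.mem₂ h.mem₁ (by grind) (by grind) (by grind)
  · rw [cross_self, add_zero]
    exact hx.limit_ne h h.mem₁ h.mem₂ (by grind) (by grind) (by grind)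

theorem IsCollision.dot_cross_ne_zero {A : Finset V} {x : V → Fin 3 → k}
    (hx : IsGeneric A x) {a₁ b₁ a₂ b₂ : V} (h : IsCollision a₁ b₁ a₂ b₂ A) {c c' : V}
    (hc : c ∈ A) (hc' : c' ∈ A) (hcc : c ≠ c') (h1 : c ≠ a₁) (h2 : c' ≠ a₁) (h3 : c ≠ a₂)
    (h4 : c' ≠ a₂) : x c' ⬝ᵥ (((x a₁ ⨯₃ x b₁) ⨯₃ (x a₂ ⨯₃ x b₂)) ⨯₃ x c) ≠ 0 := by
  rw [dotProduct_cross_swap]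
  exact hx.limit_ne h hc hc' hcc (by grind) (by grind)

theorem IsCollision.eval_eq_zero {A : Finset V} {x : V → Fin 3 → k} (hx : IsGeneric A x)
    {a₁ b₁ a₂ b₂ : V} (h : IsCollision a₁ b₁ a₂ b₂ A) {f : MvPolynomial (Fin 3) k} {n : ℕ}
    (hf : f.IsHomogeneous n) {W : Finset V}
    (hW : ∀ c ∈ W, eval (((x a₁ ⨯₃ x b₁) ⨯₃ (x a₂ ⨯₃ x b₂)) ⨯₃ x c) f = 0) {c : V}
    (hc : (c = a₁ ∧ b₁ ∈ W) ∨ (c = a₂ ∧ b₂ ∈ W)) :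
    eval (((x a₁ ⨯₃ x b₁) ⨯₃ (x a₂ ⨯₃ x b₂)) ⨯₃ x c) f = 0 := by
  rcases hc with ⟨rfl, hb⟩ | ⟨rfl, hb⟩
  · obtain ⟨r, hr, h1⟩ := h.cross_left hx (Or.inr rfl)
    obtain ⟨r', hr', h2⟩ := h.cross_left hx (Or.inl rfl)
    have := hW _ hb
    rw [h1, eval_smul_eq_zero_iff hf hr] at this
    rw [h2, eval_smul_eq_zero_iff hf hr', this]
  · obtain ⟨r, hr, h1⟩ := h.cross_right hx (Or.inr rfl)
    obtain ⟨r', hr', h2⟩ := h.cross_right hx (Or.inl rfl)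
    have := hW _ hb
    rw [h1, eval_smul_eq_zero_iff hf hr] at this
    rw [h2, eval_smul_eq_zero_iff hf hr', this]

variable [DecidableEq V]

theorem IsCollision.finrank_limitForms_le [Infinite k] {A : Finset V} {x : V → Fin 3 → k}
    (hx : IsGeneric A x) {a₁ b₁ a₂ b₂ : V} (h : IsCollision a₁ b₁ a₂ b₂ A)
    {E E' : Finset (V × V)} {U W F : Finset V} {n : ℕ}
    (hE' : ∀ e ∈ E', e.1 ∈ A ∧ e.2 ∈ A ∧ e.1 ≠ e.2 ∧ s(e.1, e.2) ≠ s(a₁, b₁) ∧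
      s(e.1, e.2) ≠ s(a₂, b₂))
    (hE : ∀ e ∈ E, e ∈ E' ∨ (e = (a₁, b₁) ∧ a₁ ∈ U) ∨ (e = (a₂, b₂) ∧ a₂ ∈ U))
    (hW : a₁ ∉ W ∧ a₂ ∉ W) (hF : a₁ ∉ F ∧ a₂ ∉ F)
    (hA : (U \ {a₁, a₂}) ∪ W ∪ F ⊆ A) (hcard : n + 1 < #((U \ {a₁, a₂}) ∪ W ∪ F)) :
    Module.finrank k (limitForms E' U W {a₁, a₂} x ((x a₁ ⨯₃ x b₁) ⨯₃ (x a₂ ⨯₃ x b₂))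
      (x a₁ + x a₂) (n + 1)) ≤ #F + Module.finrank k (vanishing E x n) := by
  have hmem : ∀ c ∈ (U \ {a₁, a₂}) ∪ W ∪ F, c ∈ A ∧ c ≠ a₁ ∧ c ≠ a₂ := by
    intro c hc
    refine ⟨hA hc, ?_⟩
    simp only [mem_union, mem_sdiff, mem_insert, mem_singleton] at hc
    grind
  have hT1 : ∀ c ∈ (U \ {a₁, a₂}) ∪ W ∪ F, ∀ c' ∈ (U \ {a₁, a₂}) ∪ W ∪ F, c ≠ c' →
      x c' ⬝ᵥ (((x a₁ ⨯₃ x b₁) ⨯₃ (x a₂ ⨯₃ x b₂)) ⨯₃ x c) ≠ 0 := by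
    intro c hc c' hc' hcc
    obtain ⟨hc1, hc2, hc3⟩ := hmem c hc
    obtain ⟨hc1', hc2', hc3'⟩ := hmem c' hc'
    exact h.dot_cross_ne_zero hx hc1 hc1' hcc hc2 hc2' hc3 hc3'
  have hl : (x a₁ ⨯₃ x b₁) ⨯₃ (x a₂ ⨯₃ x b₂) ≠ 0 := by
    intro h0
    have := h.dot_cross_add_ne_zero hx (Or.inl rfl)
    rw [h0, zero_dotProduct] at this
    exact this rfl
  refine _root_.finrank_limitForms_le hl (fun e he => ?_) (fun e he => ?_) subset_rfl hcard ?_ hT1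
  · obtain ⟨h1, h2, h3, h4, h5⟩ := hE' e he
    exact hx.limit_ne h h1 h2 h3 h4 h5
  · refine (hE e he).imp_right ?_
    rintro (⟨rfl, hU⟩ | ⟨rfl, hU⟩)
    · exact ⟨a₁, hU, by simp, h.dot_cross_add_ne_zero hx (Or.inl rfl),
        h.cross_left hx (Or.inl rfl)⟩
    · exact ⟨a₂, hU, by simp, h.dot_cross_add_ne_zero hx (Or.inr rfl),
        h.cross_right hx (Or.inl rfl)⟩
  · intro c hc h0
    obtain ⟨c', hc', hcc⟩ := exists_mem_ne (by omega : 1 < #((U \ {a₁, a₂}) ∪ W ∪ F)) c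
    have := hT1 c hc c' hc' hcc.symm
    rw [h0, dotProduct_zero] at this
    exact this rfl

theorem GenBound.of_degeneration [Infinite k] [Infinite V] {E E₁ : Finset (V × V)}
    {U W : Finset V} {u w a₁ b₁ a₂ b₂ : V} {n N : ℕ} (h : GenBound k E₁ n N) (huw : u ≠ w)
    (hn : [a₁, b₁, a₂, b₂].Nodup) (huU : u ∉ U) (hwU : w ∉ U) (huW : u ∉ W) (hwW : w ∉ W)
    (hEU : ∀ c ∈ U, (u, c) ∈ E) (hEW : ∀ c ∈ W, (w, c) ∈ E) (haW : a₁ ∉ W ∧ a₂ ∉ W)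
    (h₁ : a₁ ∈ U → b₁ ∈ W) (h₂ : a₂ ∈ U → b₂ ∈ W)
    (hE₁ : ∀ e ∈ E₁, (e ∈ E ∧ e.1 ≠ u ∧ e.1 ≠ w ∧ e.2 ≠ u ∧ e.2 ≠ w ∧ e.1 ≠ e.2 ∧
      s(e.1, e.2) ≠ s(a₁, b₁) ∧ s(e.1, e.2) ≠ s(a₂, b₂)) ∨ (e = (a₁, b₁) ∧ a₁ ∈ U) ∨
      (e = (a₂, b₂) ∧ a₂ ∈ U)) :
    GenBound k E (n + 1) (N + (n + 2 - #((U \ {a₁, a₂}) ∪ W))) := by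
  set S := (U \ {a₁, a₂}) ∪ W with hSdef
  have haS : a₁ ∉ S ∧ a₂ ∉ S := by
    simp only [hSdef, mem_union, mem_sdiff, mem_insert, mem_singleton]
    grind
  let T := S ∪ {a₁, a₂}
  obtain ⟨B, hTB, hB⟩ := Infinite.exists_superset_card_eq T (#T + (n + 2 - #S)) (by omega)
  let F := B \ T
  have hFcard : #F = n + 2 - #S := by rw [card_sdiff_of_subset hTB, hB]; omega
  have hSF : n + 1 < #(S ∪ F) := by
    have hd : Disjoint S F := by
      refine Finset.disjoint_left.2 fun c hc hc' => (mem_sdiff.1 hc').2 (mem_union_left _ hc)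
    rw [card_union_of_disjoint hd, hFcard]
    omega
  let A := S ∪ F ∪ {a₁, b₁, a₂, b₂} ∪ (E₁.image Prod.fst ∪ E₁.image Prod.snd)
  have hcol : IsCollision a₁ b₁ a₂ b₂ A := ⟨hn, by simp [A], by simp [A], by simp [A], by simp [A]⟩
  obtain ⟨x, hx, hxN⟩ := h.exists_isGeneric A
  let E' := E₁.filter fun e => e ∈ E ∧ e.1 ≠ u ∧ e.1 ≠ w ∧ e.2 ≠ u ∧ e.2 ≠ w ∧ e.1 ≠ e.2 ∧
      s(e.1, e.2) ≠ s(a₁, b₁) ∧ s(e.1, e.2) ≠ s(a₂, b₂)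
  have hfin := hcol.finrank_limitForms_le hx (E := E₁) (E' := E') (U := U) (W := W) (F := F)
    (n := n) ?_ ?_ haW ?_ ?_ hSF
  · refine Exists.imp (fun y hy => hy.trans (hfin.trans (by omega)))
      (genBound_limitForms (E' := E') (M := {a₁, a₂}) huw huU hwU huW hwW hEU hEW
      ?_ x ((x a₁ ⨯₃ x b₁) ⨯₃ (x a₂ ⨯₃ x b₂)) (x a₁ + x a₂) (n + 1) ?_)
    · intro e he
      obtain ⟨h1, h2, h3, h4, h5, -⟩ := (mem_filter.1 he).2
      exact ⟨h1, h2, h3, h4, h5⟩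
    · intro f hf c hc hcM
      obtain ⟨⟨hf0, -⟩, hf2⟩ := mem_baseForms.1 hf
      refine hcol.eval_eq_zero hx hf0 hf2 ?_
      rcases mem_insert.1 hcM with rfl | hcM
      · exact Or.inl ⟨rfl, h₁ hc⟩
      · rw [mem_singleton] at hcM
        subst hcM
        exact Or.inr ⟨rfl, h₂ hc⟩
  · intro e he
    obtain ⟨he1, -, -, -, -, -, h3, h4, h5⟩ := mem_filter.1 he
    exact ⟨mem_union_right _ (mem_union_left _ (mem_image_of_mem _ he1)),
      mem_union_right _ (mem_union_right _ (mem_image_of_mem _ he1)), h3, h4, h5⟩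
  · intro e he
    exact (hE₁ e he).imp_left fun h => mem_filter.2 ⟨he, h⟩
  · simp [F, T]
  · exact subset_union_left.trans subset_union_left

end Move

section GenBound

open scoped Matrix

variable {k : Type*} [Field k] {V : Type*}

theorem GenBound.mono {E E' : Finset (V × V)} {n N N' : ℕ} (h : GenBound k E' n N)
    (hE : ∀ e ∈ E', e ∈ E ∨ e.swap ∈ E) (hN : N ≤ N') : GenBound k E n N' := by
  obtain ⟨x, hx⟩ := h
  refine ⟨x, (Submodule.finrank_mono fun f hf => ?_).trans (hx.trans hN)⟩
  rw [mem_vanishing] at hf ⊢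
  refine ⟨hf.1, fun e he => (hE e he).elim (hf.2 e) fun he' => ?_⟩
  have := hf.2 _ he'
  rwa [Prod.fst_swap, Prod.snd_swap, ← cross_anticomm, ← neg_one_smul k,
    eval_smul_eq_zero_iff hf.1 (neg_ne_zero.2 one_ne_zero)] at this

theorem genBound_choose (E : Finset (V × V)) (n : ℕ) : GenBound k E n ((n + 2).choose 2) := by
  refine ⟨0, (Submodule.finrank_mono (t := homogeneousSubmodule (Fin 3) k n) fun f hf => ?_).trans
    (finrank_homogeneousSubmodule_fin_three n).le⟩
  exact (mem_vanishing.1 hf).1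

theorem genBound_zero {E : Finset (V × V)} (hE : E.Nonempty) : GenBound k E 0 0 := by
  obtain ⟨e, he⟩ := hE
  refine ⟨0, le_of_eq (Submodule.finrank_eq_zero.2 ((Submodule.eq_bot_iff _).2 fun f hf => ?_))⟩
  rw [mem_vanishing] at hf
  obtain ⟨c, rfl⟩ : ∃ c, f = C c := ⟨_, (totalDegree_eq_zero_iff_eq_C).1
    (Nat.le_zero.1 hf.1.totalDegree_le)⟩
  simpa using hf.2 e he

/-- The combinatorial data of a degeneration step: the lines `u` and `w` move to a common limit,
the line spanned by the points `a₁ ∩ b₁` and `a₂ ∩ b₂`. -/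
structure Degeneration (V : Type*) where
  u : V
  w : V
  a₁ : V
  b₁ : V
  a₂ : V
  b₂ : V

variable [DecidableEq V]

/-- The neighbours of a vertex in a graph given by a list of edges. -/
def neighborList (L : List (V × V)) (v : V) : List V :=
  (L.filter fun e => e.1 = v).map Prod.snd ++ (L.filter fun e => e.2 = v).map Prod.fst

theorem mem_neighborList {L : List (V × V)} {v c : V} :
    c ∈ neighborList L v ↔ (v, c) ∈ L ∨ (c, v) ∈ L := by
  simp [neighborList]

namespace Degeneration

/-- The conditions under which a degeneration step can be performed. -/
def IsValid (m : Degeneration V) (L : List (V × V)) : Prop :=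
  m.u ≠ m.w ∧ [m.a₁, m.b₁, m.a₂, m.b₂].Nodup ∧ m.u ∉ neighborList L m.u ∧
    m.w ∉ neighborList L m.u ∧ m.u ∉ neighborList L m.w ∧ m.w ∉ neighborList L m.w ∧
    (m.a₁ ∉ neighborList L m.w ∧ m.a₂ ∉ neighborList L m.w) ∧
    (m.a₁ ∈ neighborList L m.u → m.b₁ ∈ neighborList L m.w) ∧
    (m.a₂ ∈ neighborList L m.u → m.b₂ ∈ neighborList L m.w)

instance (m : Degeneration V) (L : List (V × V)) : Decidable (m.IsValid L) := by
  unfold IsValid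
  infer_instance

/-- The edges of the residual graph. -/
def residual (m : Degeneration V) (L : List (V × V)) : List (V × V) :=
  (if m.a₁ ∈ neighborList L m.u then [(m.a₁, m.b₁)] else []) ++
    (if m.a₂ ∈ neighborList L m.u then [(m.a₂, m.b₂)] else []) ++
    L.filter fun e => e.1 ≠ m.u ∧ e.1 ≠ m.w ∧ e.2 ≠ m.u ∧ e.2 ≠ m.w ∧ e.1 ≠ e.2 ∧
      s(e.1, e.2) ≠ s(m.a₁, m.b₁) ∧ s(e.1, e.2) ≠ s(m.a₂, m.b₂)

/-- The number of points in the trace on the limit line. -/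
def traceCard (m : Degeneration V) (L : List (V × V)) : ℕ :=
  #(((neighborList L m.u).toFinset \ {m.a₁, m.a₂}) ∪ (neighborList L m.w).toFinset)

/-- The bound for the dimension of the space of forms of degree `n` vanishing on a general
configuration which results from a sequence of degenerations. -/
def bound : List (Degeneration V) → List (V × V) → ℕ → ℕ
  | m :: ms, L, n + 1 =>
    if m.IsValid L then bound ms (m.residual L) n + (n + 2 - m.traceCard L)
    else (n + 3).choose 2
  | _, L, n => if n = 0 ∧ L ≠ [] then 0 else (n + 2).choose 2

theorem genBound [Infinite k] [Infinite V] (ms : List (Degeneration V)) (L : List (V × V))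
    (n : ℕ) : GenBound k L.toFinset n (bound ms L n) := by
  have base (L : List (V × V)) (n : ℕ) :
      GenBound k L.toFinset n (if n = 0 ∧ L ≠ [] then 0 else (n + 2).choose 2) := by
    split_ifs with h
    · obtain ⟨rfl, h⟩ := h
      exact genBound_zero (by simpa [List.toFinset_nonempty_iff] using h)
    · exact genBound_choose _ _
  induction ms generalizing L n with
  | nil => exact base _ _
  | cons m ms ih =>
    cases n with
    | zero => exact base _ _
    | succ n =>
      rw [bound]
      split_ifs with h
      swap
      · exact genBound_choose _ _
      obtain ⟨h1, h2, h3, h4, h5, h6, h7, h8, h9⟩ := h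
      have key := (ih (m.residual L) n).of_degeneration
        (E := L.toFinset ∪ L.toFinset.image Prod.swap)
        (U := (neighborList L m.u).toFinset) (W := (neighborList L m.w).toFinset)
        h1 h2 (by simpa) (by simpa) (by simpa) (by simpa) ?_ ?_ (by simpa) (by simpa) (by simpa) ?_
      · exact key.mono (by simp) le_rfl
      · intro c hc
        simpa [mem_neighborList] using hc
      · intro c hc
        simpa [mem_neighborList] using hc
      · intro e he
        simp only [residual, List.mem_toFinset, List.mem_append, List.mem_filter,
          decide_eq_true_eq] at he
        rcases he with (he | he) | ⟨he, h⟩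
        · right; left
          split_ifs at he with h
          · exact ⟨by simpa using he, by simpa using h⟩
          · simp at he
        · right; right
          split_ifs at he with h
          · exact ⟨by simpa using he, by simpa using h⟩
          · simp at he
        · exact Or.inl ⟨by simp [he], h⟩

end Degeneration

end GenBound

section Certificates

/-- The pairs of lines in two general completely reducible members of `X_{2,l}`, `l = (l₀, …)`,
taken from different forms of the same member. The line `(b, i, p)` is the `p`-th line in the
`i`-th form of the member `b`. -/
def edgeList (r : ℕ) (l : ℕ → ℕ) : List ((ℕ × ℕ × ℕ) × (ℕ × ℕ × ℕ)) :=
  [0, 1].flatMap fun b => (List.range r).flatMap fun j => (List.range j).flatMap fun i =>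
    (List.range (l i)).flatMap fun p => (List.range (l j)).map fun q => ((b, i, p), (b, j, q))

theorem mem_edgeList {r : ℕ} {l : ℕ → ℕ} {e : (ℕ × ℕ × ℕ) × (ℕ × ℕ × ℕ)} :
    e ∈ edgeList r l ↔ (e.1.1 = 0 ∨ e.1.1 = 1) ∧ e.2.1 = e.1.1 ∧ e.1.2.1 < e.2.2.1 ∧
      e.2.2.1 < r ∧ e.1.2.2 < l e.1.2.1 ∧ e.2.2.2 < l e.2.2.1 := by
  obtain ⟨⟨b, i, p⟩, ⟨b', j, q⟩⟩ := e
  simp only [edgeList, List.mem_flatMap, List.mem_range, List.mem_map, Prod.mk.injEq,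
    List.mem_cons, List.not_mem_nil, or_false]
  constructor
  · rintro ⟨b, hb, j, hj, i, hi, p, hp, q, hq, ⟨rfl, rfl, rfl⟩, rfl, rfl, rfl⟩
    exact ⟨hb, rfl, hi, hj, hp, hq⟩
  · rintro ⟨hb, rfl, hi, hj, hp, hq⟩
    exact ⟨_, hb, _, hj, _, hi, _, hp, _, hq, ⟨rfl, rfl, rfl⟩, rfl, rfl, rfl⟩

theorem length_edgeList (r : ℕ) (l : ℕ → ℕ) :
    (edgeList r l).length = 2 * ∑ j ∈ range r, ∑ i ∈ range j, l i * l j := by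
  have h (f : ℕ → ℕ) (n : ℕ) : ((List.range n).map f).sum = ∑ i ∈ range n, f i := by
    induction n with
    | zero => simp
    | succ n ih => rw [List.sum_range_succ, ih, sum_range_succ]
  simp [edgeList, List.length_flatMap, two_mul, h]

/-- The forms of degree `∑ l i` through the singular points of two general completely reducible
members of `X_{2,l}` make up a space of dimension at most `N`. -/
def TypeBound (k : Type*) [Field k] (r : ℕ) (l : ℕ → ℕ) (N : ℕ) : Prop :=
  GenBound k (edgeList r l).toFinset (∑ i ∈ range r, l i) N

/-- Extension of a list of natural numbers by zeros. -/
def padList (b : List ℕ) (i : ℕ) : ℕ := b.getD i 0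

variable {k : Type*} [Field k] [Infinite k]

theorem TypeBound.of_certificate (ms : List (Degeneration (ℕ × ℕ × ℕ))) {r : ℕ} {l : ℕ → ℕ}
    {N : ℕ} (h : Degeneration.bound ms (edgeList r l) (∑ i ∈ range r, l i) ≤ N) :
    TypeBound k r l N :=
  (Degeneration.genBound ms _ _).mono (fun _ => Or.inl) h

namespace Degeneration

/-- A degeneration of two lines to a general line. -/
def plain (u w : ℕ × ℕ × ℕ) : Degeneration (ℕ × ℕ × ℕ) :=
  ⟨u, w, (2, 0, 0), (2, 0, 1), (2, 0, 2), (2, 0, 3)⟩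

/-- A degeneration of one line to a general line. -/
def single (u : ℕ × ℕ × ℕ) : Degeneration (ℕ × ℕ × ℕ) := plain u (3, 0, 0)

/-- A degeneration of two lines to a line through the intersection of `a` and `b`. -/
def collide (u w a b : ℕ × ℕ × ℕ) : Degeneration (ℕ × ℕ × ℕ) :=
  ⟨u, w, a, b, (2, 0, 2), (2, 0, 3)⟩

end Degeneration

open Degeneration

theorem typeBound_2_2_2 : TypeBound k 3 (padList [2, 2, 2]) 4 :=
  .of_certificate
    [collide (0, 0, 0) (1, 2, 1) (0, 1, 1) (1, 1, 0), plain (0, 2, 1) (1, 1, 1),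
      plain (0, 0, 1) (1, 0, 0), plain (0, 2, 0) (1, 0, 1), single (1, 1, 0)]
    (by decide +kernel)

theorem typeBound_3_3_2 : TypeBound k 3 (padList [3, 3, 2]) 3 :=
  .of_certificate
    [collide (0, 1, 2) (1, 1, 1) (0, 2, 0) (1, 0, 0), plain (0, 0, 0) (1, 0, 2),
      collide (0, 0, 2) (1, 2, 1) (0, 2, 0) (1, 0, 1), plain (0, 2, 1) (1, 1, 0),
      plain (0, 1, 1) (1, 1, 2), single (0, 2, 0), plain (0, 0, 1) (1, 2, 0)]
    (by decide +kernel)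

theorem typeBound_4_4_2 : TypeBound k 3 (padList [4, 4, 2]) 2 :=
  .of_certificate
    [collide (0, 1, 0) (1, 1, 0) (0, 2, 0) (1, 2, 0), single (0, 2, 0), plain (0, 0, 0) (1, 0, 2),
      collide (0, 1, 1) (1, 1, 2) (0, 2, 1) (1, 0, 0), plain (0, 0, 1) (1, 0, 3),
      collide (0, 1, 3) (1, 2, 0) (0, 0, 2) (1, 1, 1), plain (0, 0, 3) (1, 0, 1), single (1, 0, 0),
      single (0, 0, 2), single (1, 2, 1)]
    (by decide +kernel)

theorem typeBound_5_5_2 : TypeBound k 3 (padList [5, 5, 2]) 1 :=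
  .of_certificate
    [collide (0, 0, 2) (1, 0, 3) (0, 1, 0) (1, 2, 1), plain (0, 1, 4) (1, 1, 0),
      collide (0, 0, 0) (1, 0, 1) (0, 1, 2) (1, 1, 1), plain (0, 1, 3) (1, 1, 3),
      collide (0, 1, 1) (1, 0, 2) (0, 0, 4) (1, 2, 0),
      collide (0, 2, 0) (1, 1, 2) (0, 1, 0) (1, 0, 4), plain (0, 0, 1) (1, 0, 0),
      plain (0, 0, 3) (1, 1, 4), single (1, 0, 4), single (0, 0, 4), single (1, 1, 1),
      single (0, 1, 0)]
    (by decide +kernel)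

theorem typeBound_6_6_2 : TypeBound k 3 (padList [6, 6, 2]) 0 :=
  .of_certificate
    [collide (0, 0, 3) (1, 1, 2) (0, 2, 0) (1, 0, 1), plain (0, 1, 2) (1, 0, 4),
      collide (0, 0, 5) (1, 0, 2) (0, 1, 0) (1, 1, 3), plain (0, 1, 4) (1, 1, 4),
      collide (0, 1, 5) (1, 1, 5) (0, 0, 4) (1, 2, 0), plain (0, 0, 0) (1, 0, 5),
      collide (0, 1, 3) (1, 0, 3) (0, 2, 1) (1, 1, 1), plain (0, 0, 2) (1, 1, 0),
      collide (0, 1, 1) (1, 2, 1) (0, 0, 4) (1, 1, 1), plain (0, 0, 1) (1, 0, 0), single (0, 0, 4),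
      single (1, 0, 1), single (0, 1, 0), single (1, 2, 0)]
    (by decide +kernel)

theorem typeBound_3_3_3 : TypeBound k 3 (padList [3, 3, 3]) 1 :=
  .of_certificate
    [⟨(0, 2, 2), (1, 1, 1), (0, 1, 0), (1, 2, 1), (0, 1, 2), (1, 0, 2)⟩,
      collide (0, 1, 1) (1, 0, 0) (0, 2, 1) (1, 1, 0), plain (0, 0, 1) (1, 2, 2),
      collide (0, 2, 0) (1, 0, 1) (0, 1, 0) (1, 2, 0), plain (0, 0, 0) (1, 1, 2), single (1, 1, 0),
      single (0, 1, 0), single (0, 1, 2), single (1, 0, 2)]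
    (by decide +kernel)

theorem typeBound_4_3_3 : TypeBound k 3 (padList [4, 3, 3]) 0 :=
  .of_certificate
    [⟨(0, 2, 2), (1, 0, 3), (0, 0, 1), (1, 1, 1), (0, 0, 2), (1, 2, 2)⟩,
      collide (0, 0, 0) (1, 0, 1) (0, 2, 0) (1, 1, 1),
      collide (0, 0, 3) (1, 2, 1) (0, 1, 1) (1, 1, 0), plain (0, 1, 2) (1, 1, 2),
      collide (0, 2, 1) (1, 0, 0) (0, 1, 1) (1, 2, 2), plain (0, 1, 0) (1, 2, 0), single (0, 1, 1),
      single (1, 2, 2), single (0, 2, 0), single (1, 1, 1)]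
    (by decide +kernel)

theorem typeBound_1_1_1_1 : TypeBound k 4 (padList [1, 1, 1, 1]) 3 :=
  .of_certificate
    [single (0, 0, 0), collide (0, 1, 0) (1, 1, 0) (0, 2, 0) (1, 2, 0), single (1, 0, 0),
      single (0, 2, 0)]
    (by decide +kernel)

theorem typeBound_2_2_1_1 : TypeBound k 4 (padList [2, 2, 1, 1]) 2 :=
  .of_certificate
    [single (0, 3, 0), collide (0, 1, 0) (1, 1, 1) (0, 0, 1) (1, 3, 0),
      collide (0, 2, 0) (1, 0, 0) (0, 0, 0) (1, 1, 0), single (1, 3, 0), single (1, 1, 0),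
      single (0, 1, 1)]
    (by decide +kernel)

theorem typeBound_3_3_1_1 : TypeBound k 4 (padList [3, 3, 1, 1]) 1 :=
  .of_certificate
    [collide (0, 1, 1) (1, 0, 1) (0, 2, 0) (1, 1, 1),
      collide (0, 1, 0) (1, 1, 0) (0, 0, 1) (1, 2, 0), plain (0, 0, 2) (1, 1, 2),
      plain (0, 0, 0) (1, 0, 0), collide (0, 1, 2) (1, 0, 2) (0, 3, 0) (1, 3, 0), single (0, 0, 1),
      single (1, 3, 0), single (0, 2, 0)]
    (by decide +kernel)

theorem typeBound_4_4_1_1 : TypeBound k 4 (padList [4, 4, 1, 1]) 0 :=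
  .of_certificate
    [collide (0, 0, 1) (1, 0, 1) (0, 3, 0) (1, 1, 2),
      collide (0, 0, 0) (1, 1, 1) (0, 1, 2) (1, 0, 3), plain (0, 1, 1) (1, 0, 2),
      plain (0, 1, 0) (1, 1, 0), collide (0, 0, 2) (1, 1, 3) (0, 1, 3) (1, 0, 3),
      collide (0, 2, 0) (1, 0, 0) (0, 0, 3) (1, 3, 0), single (1, 0, 3), single (0, 3, 0),
      single (0, 0, 3), single (1, 3, 0)]
    (by decide +kernel)

theorem typeBound_1_1_1_1_1 : TypeBound k 5 (padList [1, 1, 1, 1, 1]) 1 :=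
  .of_certificate
    [⟨(0, 3, 0), (1, 1, 0), (0, 1, 0), (1, 2, 0), (0, 2, 0), (1, 4, 0)⟩, single (1, 4, 0),
      single (0, 1, 0), collide (0, 4, 0) (1, 3, 0) (0, 2, 0) (1, 0, 0), single (1, 0, 0)]
    (by decide +kernel)

theorem typeBound_2_1_1_1_1 : TypeBound k 5 (padList [2, 1, 1, 1, 1]) 0 :=
  .of_certificate
    [⟨(0, 1, 0), (1, 0, 0), (0, 0, 0), (1, 3, 0), (0, 3, 0), (1, 2, 0)⟩,
      ⟨(0, 4, 0), (1, 1, 0), (0, 0, 0), (1, 0, 1), (0, 3, 0), (1, 3, 0)⟩, single (0, 3, 0),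
      single (1, 0, 1), single (1, 3, 0), single (0, 2, 0)]
    (by decide +kernel)

theorem typeBound_1_1_1_1_1_1 : TypeBound k 6 (padList [1, 1, 1, 1, 1, 1]) 0 :=
  .of_certificate
    [⟨(0, 5, 0), (1, 4, 0), (0, 4, 0), (1, 0, 0), (0, 0, 0), (1, 5, 0)⟩,
      ⟨(0, 1, 0), (1, 2, 0), (0, 3, 0), (1, 3, 0), (0, 0, 0), (1, 0, 0)⟩, single (1, 0, 0),
      single (0, 3, 0), single (1, 5, 0), single (0, 4, 0)]
    (by decide +kernel)

theorem typeBound_2_2_2_1 : TypeBound k 4 (padList [2, 2, 2, 1]) 0 :=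
  .of_certificate
    [⟨(0, 1, 0), (1, 2, 1), (0, 3, 0), (1, 3, 0), (0, 0, 1), (1, 0, 1)⟩,
      collide (0, 0, 0) (1, 1, 0) (0, 2, 1) (1, 3, 0), plain (0, 2, 0) (1, 0, 0), single (1, 3, 0),
      single (0, 0, 1), collide (0, 1, 1) (1, 0, 1) (0, 2, 1) (1, 1, 1), single (1, 1, 1)]
    (by decide +kernel)

end Certificates

section Peeling

variable {k : Type*} [Field k]

theorem TypeBound.congr {r r' : ℕ} {l l' : ℕ → ℕ} {N N' : ℕ} (h : TypeBound k r l N)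
    (hr : r ≤ r') (hl : ∀ i < r, l i = l' i) (hl' : ∀ i < r', r ≤ i → l' i = 0) (hN : N ≤ N') :
    TypeBound k r' l' N' := by
  have hsum : ∑ i ∈ range r', l' i = ∑ i ∈ range r, l i := by
    rw [sum_congr rfl fun i hi => hl i (mem_range.1 hi)]
    refine (sum_subset (range_subset_range.2 hr) fun i hi hi' => hl' i (mem_range.1 hi) ?_).symm
    simpa using hi'
  rw [TypeBound, hsum]
  refine GenBound.mono h (fun e he => Or.inl ?_) hN
  rw [List.mem_toFinset, mem_edgeList] at he ⊢
  obtain ⟨h1, h2, h3, h4, h5, h6⟩ := he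
  rw [hl _ (h3.trans h4)] at h5
  rw [hl _ h4] at h6
  exact ⟨h1, h2, h3, h4.trans_le hr, h5, h6⟩

theorem TypeBound.peel [Infinite k] {r : ℕ} {l : ℕ → ℕ} {N : ℕ} (h : TypeBound k r l N) {i : ℕ}
    (hi : i < r) :
    TypeBound k r (Function.update l i (l i + 1)) (N + (2 * l i + 2 - ∑ j ∈ range r, l j)) := by
  let X (b : ℕ) : Finset (ℕ × ℕ × ℕ) :=
    (((range r).erase i).sigma fun j => range (l j)).image fun s => (b, s.1, s.2)
  have hX : ∀ b c, c ∈ X b ↔ c.1 = b ∧ c.2.1 < r ∧ c.2.1 ≠ i ∧ c.2.2 < l c.2.1 := by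
    rintro b ⟨b', j, q⟩
    simp only [X, mem_image, mem_sigma, mem_erase, mem_range, Sigma.exists, Prod.mk.injEq]
    constructor
    · rintro ⟨j, q, ⟨⟨h1, h2⟩, h3⟩, rfl, rfl, rfl⟩
      exact ⟨rfl, h2, h1, h3⟩
    · rintro ⟨rfl, h2, h1, h3⟩
      exact ⟨j, q, ⟨⟨h1, h2⟩, h3⟩, rfl, rfl, rfl⟩
  have hXcard : ∀ b, #(X b) = ∑ j ∈ (range r).erase i, l j := by
    intro b
    rw [card_image_of_injective, card_sigma]
    · simp
    · rintro ⟨j, q⟩ ⟨j', q'⟩ h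
      simp only [Prod.mk.injEq, true_and] at h
      obtain ⟨rfl, rfl⟩ := h
      rfl
  have hsum : ∑ j ∈ range r, Function.update l i (l i + 1) j = ∑ j ∈ range r, l j + 1 := by
    rw [sum_update_of_mem (mem_range.2 hi), ← add_sum_erase _ l (mem_range.2 hi),
      sdiff_singleton_eq_erase]
    ring
  have hlt : ∀ j, l j ≤ Function.update l i (l i + 1) j := by
    intro j
    by_cases hj : j = i <;> simp [hj]
  have hself : l i < Function.update l i (l i + 1) i := by simp
  let E := (edgeList r (Function.update l i (l i + 1))).toFinset
  have hE : ∀ b, b = 0 ∨ b = 1 → ∀ c ∈ X b, ((b, i, l i), c) ∈ E ∪ E.image Prod.swap := by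
    rintro b hb ⟨b', j, q⟩ hc
    obtain ⟨h1, h2, h3, h4⟩ := (hX b _).1 hc
    simp only [mem_union, mem_image, Prod.exists, Prod.swap_prod_mk, Prod.mk.injEq, E,
      List.mem_toFinset, mem_edgeList] at h1 h2 h3 h4 ⊢
    subst h1
    rcases lt_or_gt_of_ne h3 with h3 | h3
    · exact Or.inr ⟨b', j, q, b', i, l i, ⟨hb, rfl, h3, hi, h4.trans_le (hlt j), hself⟩,
        ⟨rfl, rfl, rfl⟩, rfl, rfl, rfl⟩
    · exact Or.inl ⟨hb, rfl, h3, h2, hself, h4.trans_le (hlt j)⟩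
  have key := GenBound.of_degeneration (E := E ∪ E.image Prod.swap) (U := X 0) (W := X 1)
    (u := (0, i, l i)) (w := (1, i, l i)) (a₁ := (2, 0, 0)) (b₁ := (2, 0, 1)) (a₂ := (2, 0, 2))
    (b₂ := (2, 0, 3)) h (by simp) (by simp) (by simp [hX]) (by simp [hX]) (by simp [hX])
    (by simp [hX]) (hE 0 (Or.inl rfl)) (hE 1 (Or.inr rfl)) (by simp [hX]) (by simp [hX])
    (by simp [hX]) ?_
  · rw [TypeBound, hsum]
    refine key.mono (by simp [E]) ?_
    have hdis : Disjoint (X 0) (X 1) := by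
      refine Finset.disjoint_left.2 fun c hc hc' => ?_
      have h0 := ((hX _ _).1 hc).1
      have h1 := ((hX _ _).1 hc').1
      omega
    have hsd : X 0 \ {(2, 0, 0), (2, 0, 2)} = X 0 := by
      refine sdiff_eq_self_of_disjoint (Finset.disjoint_left.2 fun c hc hc' => ?_)
      have h0 := ((hX _ _).1 hc).1
      simp only [mem_insert, mem_singleton] at hc'
      rcases hc' with rfl | rfl <;> simp at h0
    rw [hsd, card_union_of_disjoint hdis, hXcard, hXcard]
    have := add_sum_erase _ l (mem_range.2 hi)
    omega
  · rintro ⟨⟨b, j, p⟩, ⟨b', j', p'⟩⟩ he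
    left
    simp only [List.mem_toFinset, mem_edgeList] at he
    obtain ⟨h1, rfl, h3, h4, h5, h6⟩ := he
    refine ⟨mem_union_left _ ?_, ?_, ?_, ?_, ?_, ?_, ?_, ?_⟩
    · simp only [E, List.mem_toFinset, mem_edgeList]
      exact ⟨h1, trivial, h3, h4, h5.trans_le (hlt _), h6.trans_le (hlt _)⟩
    all_goals grind

/-- The strict polygon inequalities. -/
def IsPolygon (r : ℕ) (l : ℕ → ℕ) : Prop := ∀ i < r, 2 * l i < ∑ j ∈ range r, l j

theorem sum_range_eq_add_update {r : ℕ} {l : ℕ → ℕ} {i : ℕ} (hi : i < r) (hl : 0 < l i) :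
    ∑ j ∈ range r, l j = ∑ j ∈ range r, Function.update l i (l i - 1) j + 1 := by
  rw [sum_update_of_mem (mem_range.2 hi), ← add_sum_erase _ l (mem_range.2 hi),
    sdiff_singleton_eq_erase]
  omega

theorem IsPolygon.exists_pred {r : ℕ} {b l : ℕ → ℕ} (hb : IsPolygon r b)
    (hb' : ∀ i < r, ∀ j < r, i ≠ j → b i + b j + 2 ≤ ∑ m ∈ range r, b m)
    (hl : IsPolygon r l) (hbl : ∀ i < r, b i ≤ l i) (hne : ∃ i < r, b i < l i) :
    ∃ i < r, b i < l i ∧ IsPolygon r (Function.update l i (l i - 1)) := by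
  have hlt : ∑ j ∈ range r, b j < ∑ j ∈ range r, l j :=
    sum_lt_sum (fun i hi => hbl i (mem_range.1 hi)) (by simpa using hne)
  obtain ⟨i, hi, hil, hmax⟩ : ∃ i < r, b i < l i ∧
      ∀ j < r, j ≠ i → 2 * l j + 1 < ∑ m ∈ range r, l m := by
    by_cases hv : ∃ j < r, ∑ m ∈ range r, l m ≤ 2 * l j + 1
    · obtain ⟨j, hj, hj'⟩ := hv
      have h1 := hl j hj
      have h2 := hb j hj
      refine ⟨j, hj, by omega, fun m hm hmj => ?_⟩
      have h3 := hl m hm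
      have h4 := hb' j hj m hm hmj.symm
      have h5 : ∀ f : ℕ → ℕ, ∑ m ∈ range r, f m = f j + (f m +
          ∑ i ∈ ((range r).erase j).erase m, f i) := fun f => by
        rw [add_sum_erase _ f (mem_erase.2 ⟨hmj, mem_range.2 hm⟩),
          add_sum_erase _ f (mem_range.2 hj)]
      have h6 : ∑ i ∈ ((range r).erase j).erase m, b i ≤ ∑ i ∈ ((range r).erase j).erase m, l i :=
        sum_le_sum fun i hi => hbl i (mem_range.1 (mem_of_mem_erase (mem_of_mem_erase hi)))
      have h7 := h5 b
      have h8 := h5 l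
      omega
    · push Not at hv
      obtain ⟨i, hi, hil⟩ := hne
      exact ⟨i, hi, hil, fun j hj _ => hv j hj⟩
  refine ⟨i, hi, hil, fun j hj => ?_⟩
  have h1 := sum_range_eq_add_update hi (by omega : 0 < l i)
  have h2 := hl i hi
  by_cases hji : j = i
  · subst hji
    rw [Function.update_self]
    omega
  · have := hmax j hj hji
    rw [Function.update_of_ne hji]
    omega

theorem TypeBound.zero_of_isPolygon [Infinite k] {r : ℕ} {b l : ℕ → ℕ} (h : TypeBound k r b 0)
    (hb : IsPolygon r b) (hb' : ∀ i < r, ∀ j < r, i ≠ j → b i + b j + 2 ≤ ∑ m ∈ range r, b m)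
    (hl : IsPolygon r l) (hbl : ∀ i < r, b i ≤ l i) : TypeBound k r l 0 := by
  by_cases hne : ∃ i < r, b i < l i
  · obtain ⟨i, hi, hil, hpol⟩ := hb.exists_pred hb' hl hbl hne
    have ih := h.zero_of_isPolygon hb hb' hpol fun j hj => by
      rw [Function.update_apply]
      split_ifs with hji
      · subst hji
        omega
      · exact hbl j hj
    have := ih.peel hi
    rw [Function.update_self, Function.update_idem, Nat.sub_add_cancel (by omega),
      Function.update_eq_self] at this
    have h1 := sum_range_eq_add_update hi (by omega : 0 < l i)
    have h2 := hl i hi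
    exact this.congr le_rfl (fun _ _ => rfl) (fun i h1 h2 => by omega) (by omega)
  · push Not at hne
    exact h.congr le_rfl (fun i hi => le_antisymm (hbl i hi) (hne i hi))
      (fun i h1 h2 => by omega) le_rfl
termination_by ∑ i ∈ range r, l i
decreasing_by
  have h1 := sum_range_eq_add_update hi (by omega : 0 < l i)
  omega

end Peeling

section Classification

/-- The expected dimension `C(d+2,2) - 2D`, `D = ∑_{i<j} l i * l j`, without truncation. -/
def expectedDim (r : ℕ) (l : ℕ → ℕ) : ℤ :=
  ((∑ i ∈ range r, l i + 2).choose 2 : ℤ) - ((∑ i ∈ range r, (l i : ℤ)) ^ 2 -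
    ∑ i ∈ range r, (l i : ℤ) ^ 2)

/-- The upper bound for the dimension given by the nonnegative expected dimension. -/
def IsExact (k : Type*) [Field k] (r : ℕ) (l : ℕ → ℕ) : Prop :=
  ∃ N : ℕ, (N : ℤ) ≤ expectedDim r l ∧ TypeBound k r l N

theorem expectedDim_congr {r : ℕ} {l l' : ℕ → ℕ} (h : ∀ i < r, l i = l' i) :
    expectedDim r l = expectedDim r l' := by
  have h1 {M : Type} [AddCommMonoid M] (f : ℕ → M) :
      ∑ i ∈ range r, f (l i) = ∑ i ∈ range r, f (l' i) :=
    sum_congr rfl fun i hi => by rw [h i (mem_range.1 hi)]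
  rw [expectedDim, expectedDim, h1 Nat.cast, h1 fun a => (a : ℤ) ^ 2, h1 fun a => a]

theorem expectedDim_update {r : ℕ} (l : ℕ → ℕ) {i : ℕ} (hi : i < r) :
    expectedDim r (Function.update l i (l i + 1)) =
      expectedDim r l + (2 * l i + 2 - ∑ j ∈ range r, (l j : ℤ)) := by
  have h (f : ℕ → ℤ) (g : ℕ → ℕ → ℤ) (c : ℤ) (hf : ∀ j ≠ i, g j (Function.update l i (l i + 1) j)
      = f j) (hi' : g i (l i + 1) = f i + c) : ∑ j ∈ range r,
      g j (Function.update l i (l i + 1) j) = ∑ j ∈ range r, f j + c := by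
    rw [← add_sum_erase _ _ (mem_range.2 hi), ← add_sum_erase _ f (mem_range.2 hi),
      sum_congr rfl fun j hj => hf j (ne_of_mem_erase hj), Function.update_self, hi']
    ring
  have h1 := h (fun j => l j) (fun _ a => (a : ℤ)) 1
    (fun j hj => by rw [Function.update_of_ne hj]) (by push_cast; ring)
  have h2 := h (fun j => (l j : ℤ) ^ 2) (fun _ a => (a : ℤ) ^ 2) (2 * l i + 1)
    (fun j hj => by rw [Function.update_of_ne hj]) (by push_cast; ring)
  have h3 : ∑ j ∈ range r, Function.update l i (l i + 1) j = ∑ j ∈ range r, l j + 1 := by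
    exact_mod_cast h1
  rw [expectedDim, expectedDim, h1, h2, h3, add_right_comm, Nat.choose_succ_succ' _ 1,
    Nat.choose_one_right]
  push_cast
  ring

@[simp]
theorem padList_cons_zero (a : ℕ) (L : List ℕ) : padList (a :: L) 0 = a := rfl

@[simp]
theorem padList_cons_succ (a : ℕ) (L : List ℕ) (i : ℕ) :
    padList (a :: L) (i + 1) = padList L i := by
  simp [padList]

@[simp]
theorem padList_cons_one (a : ℕ) (L : List ℕ) : padList (a :: L) 1 = padList L 0 :=
  padList_cons_succ a L 0

@[simp]
theorem padList_cons_two (a : ℕ) (L : List ℕ) : padList (a :: L) 2 = padList L 1 :=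
  padList_cons_succ a L 1

theorem sum_padList (L : List ℕ) : ∑ i ∈ range L.length, padList L i = L.sum := by
  induction L with
  | nil => simp
  | cons a L ih => rw [List.length_cons, sum_range_succ']; simp [ih, add_comm]

variable {k : Type*} [Field k]

theorem IsExact.congr {r : ℕ} {l l' : ℕ → ℕ} (h : IsExact k r l) (hl : ∀ i < r, l i = l' i) :
    IsExact k r l' := by
  obtain ⟨N, hN, hb⟩ := h
  exact ⟨N, by rwa [← expectedDim_congr hl],
    hb.congr le_rfl hl (fun i h1 h2 => by omega) le_rfl⟩

variable [Infinite k]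

theorem IsExact.peel {r : ℕ} {l : ℕ → ℕ} (h : IsExact k r l) {i : ℕ} (hi : i < r)
    (hl : ∑ j ∈ range r, l j ≤ 2 * l i + 2) :
    IsExact k r (Function.update l i (l i + 1)) := by
  obtain ⟨N, hN, hb⟩ := h
  refine ⟨_, ?_, hb.peel hi⟩
  rw [expectedDim_update l hi]
  push_cast [Nat.cast_sub hl]
  linarith

theorem IsExact.cons_add {r a : ℕ} {L : List ℕ} (h : IsExact k r (padList (a :: L)))
    (hr : 0 < r) (hl : ∑ j ∈ range r, padList (a :: L) j ≤ 2 * a + 2) (t : ℕ) :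
    IsExact k r (padList ((a + t) :: L)) := by
  have hupd : ∀ a b, Function.update (padList (a :: L)) 0 b = padList (b :: L) := by
    intro a b
    funext i
    cases i <;> simp
  induction t with
  | zero => exact h
  | succ t ih =>
    have := ih.peel hr ?_
    · rwa [hupd] at this
    · obtain ⟨m, rfl⟩ := Nat.exists_eq_add_of_lt hr
      rw [zero_add, sum_range_succ'] at hl ⊢
      simp only [padList_cons_succ, padList_cons_zero] at hl ⊢
      omega

theorem isExact_pair_self (b : ℕ) : IsExact k 2 (padList [b, b]) := by
  induction b with
  | zero => exact ⟨1, by decide +kernel, .of_certificate [] (by decide +kernel)⟩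
  | succ b ih =>
    refine ((ih.cons_add two_pos (by simp [sum_range_succ]; omega) 1).peel one_lt_two
      (by simp [sum_range_succ]; omega)).congr fun i hi => ?_
    interval_cases i <;> simp

theorem isExact_pair_self_one (b : ℕ) : IsExact k 3 (padList [b, b, 1]) := by
  induction b with
  | zero => exact ⟨3, by decide +kernel, .of_certificate [] (by decide +kernel)⟩
  | succ b ih =>
    refine ((ih.cons_add three_pos (by simp [sum_range_succ]; omega) 1).peel
      (by norm_num : 1 < 3) (by simp [sum_range_succ]; omega)).congr fun i hi => ?_
    interval_cases i <;> simp

theorem IsExact.of_tail {r a : ℕ} {L : List ℕ} {l : ℕ → ℕ} (h : IsExact k r (padList (a :: L)))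
    (hr : r = L.length + 1) (ha : a ≤ l 0) (hL : L.sum ≤ a + 2)
    (hl : ∀ i < L.length, l (i + 1) = padList L i) : IsExact k r l := by
  subst hr
  obtain ⟨t, ht⟩ := Nat.exists_eq_add_of_le ha
  refine (h.cons_add (Nat.succ_pos _) ?_ t).congr fun i hi => ?_
  · rw [sum_range_succ']
    simp only [padList_cons_succ, padList_cons_zero, sum_padList]
    omega
  · cases i with
    | zero => simp [ht]
    | succ i => simp [hl i (by omega)]

end Classification

section UpperBound

theorem padList_ones_le (i : ℕ) : padList [1, 1, 1, 1, 1, 1] i ≤ 1 := by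
  rcases lt_or_ge i 6 with hi | hi
  · interval_cases i <;> simp [padList]
  · simp [padList, hi]

variable {k : Type*} [Field k] [Infinite k]

theorem typeBound_ones {r : ℕ} (hr : 6 ≤ r) : TypeBound k r (padList [1, 1, 1, 1, 1, 1]) 0 :=
  typeBound_1_1_1_1_1_1.congr hr (fun _ _ => rfl)
    (fun i _ hi => List.getD_eq_default _ _ (by simpa using hi)) le_rfl

theorem isPolygon_of_antitone {m : ℕ} {l : ℕ → ℕ} (hl : ∀ i ≤ m, l i ≤ l 0)
    (h : l 0 < ∑ i ∈ range m, l (i + 1)) : IsPolygon (m + 1) l := by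
  intro i hi
  have := hl i (by omega)
  rw [sum_range_succ']
  omega

theorem isExact_three {l : ℕ → ℕ} (h1 : l 1 ≤ l 0) (h2 : l 2 ≤ l 1) (hpos : 0 < l 2)
    (h : ¬ (l 1 + l 2 ≤ l 0 ∧ 3 * (l 1 + l 2) < 2 * (l 1 * l 2))) :
    IsExact k 3 l ∨ TypeBound k 3 l 0 := by
  have step {b c : ℕ} (a : ℕ) (hb : l 1 = b) (hc : l 2 = c) (hE : IsExact k 3 (padList [a, b, c]))
      (ha : a ≤ l 0) (hbc : b + c ≤ a + 2) : IsExact k 3 l :=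
    hE.of_tail rfl ha (by simpa using hbc) fun i hi => by
      simp only [List.length_cons, List.length_nil] at hi
      interval_cases i <;> simp [hb, hc]
  have zero (b : List ℕ) (hb : TypeBound k 3 (padList b) 0) (hb' : IsPolygon 3 (padList b))
      (hb2 : ∀ i < 3, ∀ j < 3, i ≠ j → padList b i + padList b j + 2 ≤ ∑ m ∈ range 3, padList b m)
      (hl : l 0 < l 1 + l 2) (hbl : ∀ i < 3, padList b i ≤ l i) : TypeBound k 3 l 0 := by
    refine hb.zero_of_isPolygon hb' hb2 (isPolygon_of_antitone ?_ ?_) hbl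
    · intro i hi
      interval_cases i <;> omega
    · simpa [sum_range_succ] using hl
  obtain hc | hc | hc : l 2 = 1 ∨ l 2 = 2 ∨ 3 ≤ l 2 := by omega
  · exact Or.inl (step (l 1) rfl hc (isExact_pair_self_one _) h1 (by omega))
  · rw [hc] at h
    rcases le_or_gt (l 1) 6 with hb | hb
    · left
      obtain hb | hb | hb | hb | hb : l 1 = 2 ∨ l 1 = 3 ∨ l 1 = 4 ∨ l 1 = 5 ∨ l 1 = 6 := by omega
      · exact step 2 hb hc ⟨_, by decide +kernel, typeBound_2_2_2⟩ (by omega) (by omega)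
      · exact step 3 hb hc ⟨_, by decide +kernel, typeBound_3_3_2⟩ (by omega) (by omega)
      · exact step 4 hb hc ⟨_, by decide +kernel, typeBound_4_4_2⟩ (by omega) (by omega)
      · exact step 5 hb hc ⟨_, by decide +kernel, typeBound_5_5_2⟩ (by omega) (by omega)
      · exact step 6 hb hc ⟨_, by decide +kernel, typeBound_6_6_2⟩ (by omega) (by omega)
    · right
      refine zero _ typeBound_6_6_2 (by unfold IsPolygon; decide) (by decide) (by omega) ?_
      intro i hi
      interval_cases i <;> simp [padList] <;> omega
  · by_cases hb : l 1 = 3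
    · have hc : l 2 = 3 := by omega
      left
      by_cases ha : l 0 = 3
      · refine IsExact.congr (l := padList [3, 3, 3]) ⟨_, by decide +kernel, typeBound_3_3_3⟩ ?_
        intro i hi
        interval_cases i <;> simp [ha, hb, hc, padList]
      · exact step 4 hb hc ⟨_, by decide +kernel, typeBound_4_3_3⟩ (by omega) (by omega)
    · right
      have : 3 * (l 1 + l 2) < 2 * (l 1 * l 2) := by
        have : 4 ≤ l 1 := by omega
        nlinarith
      refine zero _ typeBound_4_3_3 (by unfold IsPolygon; decide) (by decide) (by omega) ?_
      intro i hi
      interval_cases i <;> simp [padList] <;> omega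

theorem isExact_four {l : ℕ → ℕ} (h1 : l 1 ≤ l 0) (h2 : l 2 ≤ l 1) (h3 : l 3 ≤ l 2)
    (hpos : 0 < l 3) (h : ¬ (l 1 + l 2 + l 3 ≤ l 0 ∧ 3 * (l 1 + l 2 + l 3) <
      2 * (l 1 * l 2 + l 1 * l 3 + l 2 * l 3))) :
    IsExact k 4 l ∨ TypeBound k 4 l 0 := by
  have zero (b : List ℕ) (hb : TypeBound k 4 (padList b) 0) (hb' : IsPolygon 4 (padList b))
      (hb2 : ∀ i < 4, ∀ j < 4, i ≠ j → padList b i + padList b j + 2 ≤ ∑ m ∈ range 4, padList b m)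
      (hl : l 0 < l 1 + l 2 + l 3) (hbl : ∀ i < 4, padList b i ≤ l i) : TypeBound k 4 l 0 := by
    refine hb.zero_of_isPolygon hb' hb2 (isPolygon_of_antitone ?_ ?_) hbl
    · intro i hi
      interval_cases i <;> omega
    · simpa [sum_range_succ] using hl
  by_cases hc : l 2 = 1
  · have he : l 3 = 1 := by omega
    have step {b : ℕ} (hb : l 1 = b) (hE : IsExact k 4 (padList [b, b, 1, 1])) :
        IsExact k 4 l := by
      refine hE.of_tail rfl (by omega) (by simp) fun i hi => ?_
      simp only [List.length_cons, List.length_nil] at hi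
      interval_cases i <;> simp [hb, hc, he, padList]
    rw [hc, he] at h
    rcases le_or_gt (l 1) 4 with hb | hb
    · left
      obtain hb | hb | hb | hb : l 1 = 1 ∨ l 1 = 2 ∨ l 1 = 3 ∨ l 1 = 4 := by omega
      · exact step hb ⟨_, by decide +kernel, typeBound_1_1_1_1⟩
      · exact step hb ⟨_, by decide +kernel, typeBound_2_2_1_1⟩
      · exact step hb ⟨_, by decide +kernel, typeBound_3_3_1_1⟩
      · exact step hb ⟨_, by decide +kernel, typeBound_4_4_1_1⟩
    · right
      refine zero _ typeBound_4_4_1_1 (by unfold IsPolygon; decide) (by decide) (by omega) ?_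
      intro i hi
      interval_cases i <;> simp [padList] <;> omega
  · right
    have : 3 * (l 1 + l 2 + l 3) < 2 * (l 1 * l 2 + l 1 * l 3 + l 2 * l 3) := by
      have h2' : 2 ≤ l 2 := by omega
      have h1' : 2 ≤ l 1 := by omega
      nlinarith [Nat.mul_le_mul h1' h2', Nat.mul_le_mul h1' hpos, Nat.mul_le_mul h2' hpos]
    refine zero _ typeBound_2_2_2_1 (by unfold IsPolygon; decide) (by decide) (by omega) ?_
    intro i hi
    interval_cases i <;> simp [padList] <;> omega

theorem isExact_five {l : ℕ → ℕ} (h1 : l 1 ≤ l 0) (h2 : l 2 ≤ l 1) (h3 : l 3 ≤ l 2)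
    (h4 : l 4 ≤ l 3) (hpos : 0 < l 4) (h : ¬ (l 1 + l 2 + l 3 + l 4 ≤ l 0 ∧
      3 * (l 1 + l 2 + l 3 + l 4) < 2 * (l 1 * l 2 + l 1 * l 3 + l 1 * l 4 + l 2 * l 3 +
        l 2 * l 4 + l 3 * l 4))) :
    IsExact k 5 l ∨ TypeBound k 5 l 0 := by
  by_cases hb : l 1 = 1
  · left
    have hc : l 2 = 1 := by omega
    have hd : l 3 = 1 := by omega
    have he : l 4 = 1 := by omega
    by_cases ha : l 0 = 1
    · refine IsExact.congr (l := padList [1, 1, 1, 1, 1])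
        ⟨_, by decide +kernel, typeBound_1_1_1_1_1⟩ fun i hi => ?_
      interval_cases i <;> simp [ha, hb, hc, hd, he, padList]
    · refine IsExact.of_tail (a := 2) (L := [1, 1, 1, 1])
        ⟨_, by decide +kernel, typeBound_2_1_1_1_1⟩ rfl (by omega) (by simp) fun i hi => ?_
      simp only [List.length_cons, List.length_nil] at hi
      interval_cases i <;> simp [hb, hc, hd, he, padList]
  · right
    have hlt : 3 * (l 1 + l 2 + l 3 + l 4) < 2 * (l 1 * l 2 + l 1 * l 3 + l 1 * l 4 +
        l 2 * l 3 + l 2 * l 4 + l 3 * l 4) := by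
      obtain ⟨a, ha⟩ := Nat.exists_eq_add_of_le (by omega : 2 ≤ l 1)
      obtain ⟨b, hb⟩ := Nat.exists_eq_add_of_le (by omega : 1 ≤ l 2)
      obtain ⟨c, hc⟩ := Nat.exists_eq_add_of_le (by omega : 1 ≤ l 3)
      obtain ⟨d, hd⟩ := Nat.exists_eq_add_of_le (by omega : 1 ≤ l 4)
      rw [ha, hb, hc, hd]
      ring_nf
      omega
    refine typeBound_2_1_1_1_1.zero_of_isPolygon (by unfold IsPolygon; decide) (by decide)
      (isPolygon_of_antitone (fun i hi => ?_) ?_) fun i hi => ?_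
    · interval_cases i <;> omega
    · simp [sum_range_succ]
      omega
    · interval_cases i <;> simp [padList] <;> omega

theorem add_pred_le_sum_range {m : ℕ} {t : ℕ → ℕ} (ht : ∀ i < m, 0 < t i) {i : ℕ} (hi : i < m) :
    t i + (m - 1) ≤ ∑ j ∈ range m, t j := by
  rw [← add_sum_erase _ t (mem_range.2 hi)]
  have := card_nsmul_le_sum ((range m).erase i) t 1
    fun j hj => ht j (mem_range.1 (mem_of_mem_erase hj))
  rw [card_erase_of_mem (mem_range.2 hi), card_range] at this
  simpa using this

theorem sum_sq_add_le_sq_sum {m : ℕ} {t : ℕ → ℕ} (ht : ∀ i < m, 0 < t i) :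
    ∑ i ∈ range m, t i ^ 2 + (m - 1) * ∑ i ∈ range m, t i ≤ (∑ i ∈ range m, t i) ^ 2 := by
  rw [mul_sum, ← sum_add_distrib, sq (∑ i ∈ range m, t i)]
  rw [sum_mul]
  refine sum_le_sum fun i hi => ?_
  have := Nat.mul_le_mul_left (t i) (add_pred_le_sum_range ht (mem_range.1 hi))
  linarith

theorem typeBound_of_six_le {m : ℕ} (hm : 5 ≤ m) {l : ℕ → ℕ} (hl : ∀ i ≤ m, l i ≤ l 0)
    (hpos : ∀ i ≤ m, 0 < l i) (h : ¬ (∑ i ∈ range m, l (i + 1) ≤ l 0 ∧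
      3 * ∑ i ∈ range m, l (i + 1) + ∑ i ∈ range m, l (i + 1) ^ 2 <
        (∑ i ∈ range m, l (i + 1)) ^ 2)) :
    TypeBound k (m + 1) l 0 := by
  have h1 := sum_sq_add_le_sq_sum (m := m) (t := fun i => l (i + 1)) fun i hi => hpos _ hi
  have h2 := add_pred_le_sum_range (m := m) (t := fun i => l (i + 1)) (fun i hi => hpos _ hi)
    (i := 0) (by omega)
  have h3 := Nat.mul_le_mul_right (∑ i ∈ range m, l (i + 1)) (by omega : 4 ≤ m - 1)
  have hsum : ∑ i ∈ range (m + 1), padList [1, 1, 1, 1, 1, 1] i = 6 := by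
    rw [← sum_subset (range_subset_range.2 (by omega : 6 ≤ m + 1))]
    · decide
    · intro i _ hi
      exact List.getD_eq_default _ _ (by simpa using hi)
  refine (typeBound_ones (by omega)).zero_of_isPolygon (fun i _ => ?_) (fun i _ j _ _ => ?_)
    (isPolygon_of_antitone hl ?_) fun i hi => (padList_ones_le i).trans (hpos i (by omega))
  · have := padList_ones_le i
    omega
  · have := padList_ones_le i
    have := padList_ones_le j
    omega
  · by_contra hlt
    exact h ⟨by omega, by omega⟩

/-- The upper bound of the Main Theorem in terms of general completely reducible curves. -/
theorem isExact_or_typeBound_zero {m : ℕ} (hm : 0 < m) {l : ℕ → ℕ}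
    (hl : ∀ i < m, l (i + 1) ≤ l i) (hpos : 0 < l m) (h : ¬ (∑ i ∈ range m, l (i + 1) ≤ l 0 ∧
      3 * ∑ i ∈ range m, l (i + 1) + ∑ i ∈ range m, l (i + 1) ^ 2 <
        (∑ i ∈ range m, l (i + 1)) ^ 2)) :
    IsExact k (m + 1) l ∨ TypeBound k (m + 1) l 0 := by
  obtain rfl | rfl | rfl | rfl | hm : m = 1 ∨ m = 2 ∨ m = 3 ∨ m = 4 ∨ 5 ≤ m := by omega
  · refine Or.inl ((isExact_pair_self (l 1)).of_tail rfl (hl 0 one_pos) (by simp) fun i hi => ?_)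
    simp only [List.length_cons, List.length_nil] at hi
    interval_cases i
    simp
  · refine isExact_three (hl 0 (by simp)) (hl 1 (by simp)) hpos fun h' => h ?_
    simp only [sum_range_succ, sum_range_zero, zero_add]
    exact ⟨h'.1, by linarith [h'.2]⟩
  · refine isExact_four (hl 0 (by simp)) (hl 1 (by simp)) (hl 2 (by simp)) hpos fun h' => h ?_
    simp only [sum_range_succ, sum_range_zero, zero_add]
    exact ⟨h'.1, by linarith [h'.2]⟩
  · refine isExact_five (hl 0 (by simp)) (hl 1 (by simp)) (hl 2 (by simp)) (hl 3 (by simp)) hpos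
      fun h' => h ?_
    simp only [sum_range_succ, sum_range_zero, zero_add]
    exact ⟨h'.1, by linarith [h'.2]⟩
  · have hle : ∀ i ≤ m, l m ≤ l i ∧ l i ≤ l 0 := by
      refine fun i hi => ⟨?_, ?_⟩
      · exact Nat.decreasingInduction' (fun j hj _ ih => ih.trans (hl j hj)) hi le_rfl
      · induction i with
        | zero => rfl
        | succ i ih => exact (hl i hi).trans (ih (by omega))
    exact Or.inr (typeBound_of_six_le hm (fun i hi => (hle i hi).2)
      (fun i hi => hpos.trans_le (hle i hi).1) h)

end UpperBound

section Degrees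

/-- The square of a sum in terms of the sum over pairs. -/
theorem two_mul_sum_filter_lt_add {ι : Type*} [Fintype ι] [LinearOrder ι] (P : ι → Prop)
    [DecidablePred P] (hP : ∀ i j, i < j → P i → P j) (f : ι → ℕ) :
    2 * ∑ q ∈ univ.filter (fun q : ι × ι => q.1 < q.2 ∧ P q.1), f q.1 * f q.2 +
      ∑ i ∈ univ.filter P, f i ^ 2 = (∑ i ∈ univ.filter P, f i) ^ 2 := by
  have hlt : ∑ q ∈ univ.filter (fun q : ι × ι => q.1 < q.2 ∧ P q.1), f q.1 * f q.2 =
      ∑ i ∈ univ.filter P, ∑ j ∈ univ.filter P, if i < j then f i * f j else 0 := by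
    simp only [sum_filter]
    rw [← univ_product_univ, sum_product]
    refine sum_congr rfl fun i _ => ?_
    by_cases hi : P i
    · simp only [hi, and_true, if_true]
      refine sum_congr rfl fun j _ => ?_
      by_cases hij : i < j
      · simp [hij, hP i j hij hi]
      · simp [hij]
    · simp [hi]
  have hgt : ∑ i ∈ univ.filter P, ∑ j ∈ univ.filter P, (if i < j then f i * f j else 0) =
      ∑ i ∈ univ.filter P, ∑ j ∈ univ.filter P, if j < i then f i * f j else 0 := by
    rw [sum_comm]
    simp only [mul_comm]
  have heq : ∑ i ∈ univ.filter P, f i ^ 2 =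
      ∑ i ∈ univ.filter P, ∑ j ∈ univ.filter P, if i = j then f i * f j else 0 := by
    refine sum_congr rfl fun i hi => ?_
    rw [sum_ite_eq, if_pos hi, sq]
  rw [two_mul]
  nth_rw 2 [hlt]
  rw [hgt, hlt, heq, sq, sum_mul_sum]
  simp only [← sum_add_distrib]
  refine sum_congr rfl fun i _ => sum_congr rfl fun j _ => ?_
  rcases lt_trichotomy i j with h | rfl | h
  · simp [h, h.ne, h.not_gt]
  · simp
  · simp [h, h.ne', h.not_gt]

theorem two_mul_Dval_add {r : ℕ} (d : Fin r → ℕ) :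
    2 * Dval d + ∑ i, d i ^ 2 = (∑ i, d i) ^ 2 := by
  have h := two_mul_sum_filter_lt_add (fun _ : Fin r => True) (fun _ _ _ _ => trivial) d
  simpa [Dval] using h

theorem two_mul_pval_add {r : ℕ} (d : Fin r → ℕ) :
    2 * pval d + ∑ i ∈ univ.filter (fun i : Fin r => i.val ≠ 0), d i ^ 2 = sval d ^ 2 :=
  two_mul_sum_filter_lt_add (fun i : Fin r => i.val ≠ 0)
    (fun i j hij _ => by have := Fin.lt_def.1 hij; omega) d

theorem sum_filter_val_ne_zero {m : ℕ} {M : Type*} [AddCommMonoid M] (f : Fin (m + 1) → M) :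
    ∑ i ∈ univ.filter (fun i : Fin (m + 1) => i.val ≠ 0), f i = ∑ i : Fin m, f i.succ := by
  rw [sum_filter, Fin.sum_univ_succ]
  simp

theorem two_mul_sum_sum_range_add (l : ℕ → ℕ) (r : ℕ) :
    2 * ∑ j ∈ range r, ∑ i ∈ range j, l i * l j + ∑ i ∈ range r, l i ^ 2 =
      (∑ i ∈ range r, l i) ^ 2 := by
  induction r with
  | zero => simp
  | succ r ih =>
    rw [sum_range_succ, sum_range_succ, sum_range_succ, add_sq, ← ih, ← sum_mul]
    ring

end Degrees

section IdealOfForms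

open scoped Matrix

variable {k : Type*} [Field k]

/-- The lines `(b, i, p)`, `p < n`. -/
def lineBlock (b i n : ℕ) : Finset (ℕ × ℕ × ℕ) := {b} ×ˢ {i} ×ˢ range n

theorem mem_lineBlock {b i n : ℕ} {a : ℕ × ℕ × ℕ} :
    a ∈ lineBlock b i n ↔ a.1 = b ∧ a.2.1 = i ∧ a.2.2 < n := by
  simp only [lineBlock, mem_product, mem_singleton, mem_range]

theorem card_lineBlock (b i n : ℕ) : #(lineBlock b i n) = n := by simp [lineBlock]

theorem mem_idealOfForms {r : ℕ} {F : Fin r → MvPolynomial (Fin 3) k}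
    {f : MvPolynomial (Fin 3) k} :
    f ∈ idealOfForms F ↔ ∀ i j, i < j → f ∈ Ideal.span {F i, F j} := by
  simp [idealOfForms]

/-- The `b`-th completely reducible curve given by the linear forms `x`. -/
noncomputable def formsOfLines {r : ℕ} (x : ℕ × ℕ × ℕ → Fin 3 → k) (b : ℕ) (d : Fin r → ℕ)
    (i : Fin r) : MvPolynomial (Fin 3) k :=
  ∏ a ∈ lineBlock b i (d i), lineForm (x a)

theorem isHomogeneous_formsOfLines {r : ℕ} (x : ℕ × ℕ × ℕ → Fin 3 → k) (b : ℕ) (d : Fin r → ℕ)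
    (i : Fin r) : (formsOfLines x b d i).IsHomogeneous (d i) := by
  have h := IsHomogeneous.prod (lineBlock b i (d i)) (fun a => lineForm (x a)) (fun _ => 1)
    fun a _ => isHomogeneous_lineForm (x a)
  rwa [sum_const, card_lineBlock, smul_eq_mul, mul_one] at h

theorem eval_eq_zero_of_mem_idealOfForms {r : ℕ} {x : ℕ × ℕ × ℕ → Fin 3 → k} {b : ℕ}
    {d : Fin r → ℕ} {f : MvPolynomial (Fin 3) k} (hf : f ∈ idealOfForms (formsOfLines x b d))
    {i j : Fin r} (hij : i < j) {a c : ℕ × ℕ × ℕ} (ha : a ∈ lineBlock b i (d i))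
    (hc : c ∈ lineBlock b j (d j)) : eval (x a ⨯₃ x c) f = 0 := by
  obtain ⟨u, v, rfl⟩ := Ideal.mem_span_pair.1 (mem_idealOfForms.1 hf i j hij)
  have h1 : eval (x a ⨯₃ x c) (formsOfLines x b d i) = 0 := by
    rw [formsOfLines, map_prod]
    exact prod_eq_zero ha (by rw [eval_lineForm, dot_self_cross])
  have h2 : eval (x a ⨯₃ x c) (formsOfLines x b d j) = 0 := by
    rw [formsOfLines, map_prod]
    exact prod_eq_zero hc (by rw [eval_lineForm, dot_cross_self])
  rw [map_add, map_mul, map_mul, h1, h2, mul_zero, mul_zero, add_zero]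

/-- Indices of lines, including more than three which belong to neither curve. -/
def lineSupport (r n : ℕ) : Finset (ℕ × ℕ × ℕ) := range 3 ×ˢ range r ×ˢ range (n + 4)

theorem exists_fresh {r n : ℕ} (hr : 0 < r) (a b c : ℕ × ℕ × ℕ) :
    ∃ e ∈ lineSupport r n, e ≠ a ∧ e ≠ b ∧ e ≠ c := by
  have hcard : #({a, b, c} : Finset (ℕ × ℕ × ℕ)) < #(lineBlock 2 0 (n + 4)) := by
    rw [card_lineBlock]
    exact card_le_three.trans_lt (by omega)
  obtain ⟨e, he, he'⟩ := exists_mem_notMem_of_card_lt_card hcard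
  rw [mem_lineBlock] at he
  simp only [mem_insert, mem_singleton, not_or] at he'
  exact ⟨e, by simp [lineSupport, he, hr], he'⟩

theorem lineBlock_subset {r n b i m : ℕ} (hb : b < 3) (hi : i < r) (hm : m ≤ n) :
    lineBlock b i m ⊆ lineSupport r n := by
  intro a ha
  rw [mem_lineBlock] at ha
  simp only [lineSupport, mem_product, mem_range]
  omega

variable {r n : ℕ} {x : ℕ × ℕ × ℕ → Fin 3 → k}

theorem IsGeneric.dot_cross_ne_zero (hr : 0 < r) (hx : IsGeneric (lineSupport r n) x)
    {a b c : ℕ × ℕ × ℕ} (ha : a ∈ lineSupport r n) (hb : b ∈ lineSupport r n)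
    (hc : c ∈ lineSupport r n) (hab : a ≠ b) (hac : a ≠ c) (hbc : b ≠ c) :
    x a ⬝ᵥ (x b ⨯₃ x c) ≠ 0 := by
  obtain ⟨e, he, h1, h2, h3⟩ := exists_fresh (n := n) hr a b c
  exact hx.triple_ne_zero ha hb hc he (by simp [*, h1.symm, h2.symm, h3.symm])

theorem IsGeneric.cross_ne_zero_of_ne (hr : 0 < r) (hx : IsGeneric (lineSupport r n) x)
    {a b : ℕ × ℕ × ℕ} (ha : a ∈ lineSupport r n) (hb : b ∈ lineSupport r n) (hab : a ≠ b) :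
    x a ⨯₃ x b ≠ 0 := by
  obtain ⟨c, hc, h1, h2, -⟩ := exists_fresh (n := n) hr a b a
  intro h
  exact hx.dot_cross_ne_zero hr hc ha hb h1 h2 hab (by rw [h, dotProduct_zero])

theorem IsGeneric.ne_zero (hr : 0 < r) (hx : IsGeneric (lineSupport r n) x)
    {a : ℕ × ℕ × ℕ} (ha : a ∈ lineSupport r n) : x a ≠ 0 := by
  obtain ⟨b, hb, h1, -⟩ := exists_fresh (n := n) hr a a a
  intro h
  exact hx.cross_ne_zero_of_ne hr ha hb h1.symm (by rw [h, map_zero, LinearMap.zero_apply])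

theorem formsOfLines_ne_zero (hx : IsGeneric (lineSupport r n) x) {b : ℕ} (hb : b < 3)
    {d : Fin r → ℕ} (hd : ∀ i, d i ≤ n) (i : Fin r) : formsOfLines x b d i ≠ 0 :=
  prod_ne_zero_iff.2 fun _ ha => lineForm_ne_zero
    (hx.ne_zero i.pos (lineBlock_subset hb i.isLt (hd i) ha))

/-- A form through all intersection points of a general arrangement lies in the ideal. -/
theorem mem_idealOfForms_of_eval (hx : IsGeneric (lineSupport r n) x) {b : ℕ} (hb : b < 3)
    {d : Fin r → ℕ} (hd : ∀ i, d i ≤ n) {f : MvPolynomial (Fin 3) k} {N : ℕ}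
    (hf : f.IsHomogeneous N) (h : ∀ i j : Fin r, i < j → ∀ a ∈ lineBlock b i (d i),
      ∀ c ∈ lineBlock b j (d j), eval (x a ⨯₃ x c) f = 0) :
    f ∈ idealOfForms (formsOfLines x b d) := by
  rw [mem_idealOfForms]
  intro i j hij
  have hr := i.pos
  have hA {i : Fin r} {a : ℕ × ℕ × ℕ} (ha : a ∈ lineBlock b i (d i)) : a ∈ lineSupport r n :=
    lineBlock_subset hb i.isLt (hd i) ha
  have hne {a c : ℕ × ℕ × ℕ} (ha : a ∈ lineBlock b i (d i)) (hc : c ∈ lineBlock b j (d j)) :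
      a ≠ c := by
    rintro rfl
    rw [mem_lineBlock] at ha hc
    have := Fin.lt_def.1 hij
    omega
  refine mem_span_prod_prod _ _ x
    (fun a ha c hc => hx.cross_ne_zero_of_ne hr (hA ha) (hA hc) (hne ha hc))
    (fun a ha c hc c' hc' hcc => hx.dot_cross_ne_zero hr (hA hc') (hA ha) (hA hc)
      (hne ha hc').symm hcc.symm (hne ha hc))
    (fun a ha a' ha' c hc haa => hx.dot_cross_ne_zero hr (hA ha') (hA ha) (hA hc)
      haa.symm (hne ha' hc) (hne ha hc)) fun a ha c hc => ?_
  rw [restrictRay_of_isHomogeneous hf, h i j hij a ha c hc, map_zero, zero_mul]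

/-- For general completely reducible curves, the forms in `I_F ∩ I_G` are those through the
singular points. -/
theorem inf_homogeneousSubmodule_eq_vanishing (hx : IsGeneric (lineSupport r n) x) {l : ℕ → ℕ}
    (hl : ∀ i < r, l i ≤ n) (N : ℕ) :
    Submodule.restrictScalars k (idealOfForms (formsOfLines x 0 fun i : Fin r => l i) ⊓
      idealOfForms (formsOfLines x 1 fun i : Fin r => l i)) ⊓ homogeneousSubmodule (Fin 3) k N =
    vanishing (edgeList r l).toFinset x N := by
  ext f
  rw [mem_vanishing, Submodule.mem_inf, Submodule.restrictScalars_mem, Submodule.mem_inf,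
    mem_homogeneousSubmodule, and_comm]
  refine and_congr_right fun hf => ⟨fun ⟨h0, h1⟩ e he => ?_, fun h => ⟨?_, ?_⟩⟩
  · rw [List.mem_toFinset, mem_edgeList] at he
    obtain ⟨hb, hb', hij, hj, hp, hq⟩ := he
    rcases hb with hb | hb
    · exact eval_eq_zero_of_mem_idealOfForms h0 (i := ⟨e.1.2.1, by omega⟩) (j := ⟨e.2.2.1, hj⟩)
        hij (mem_lineBlock.2 ⟨hb, rfl, hp⟩) (mem_lineBlock.2 ⟨hb'.trans hb, rfl, hq⟩)
    · exact eval_eq_zero_of_mem_idealOfForms h1 (i := ⟨e.1.2.1, by omega⟩) (j := ⟨e.2.2.1, hj⟩)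
        hij (mem_lineBlock.2 ⟨hb, rfl, hp⟩) (mem_lineBlock.2 ⟨hb'.trans hb, rfl, hq⟩)
  all_goals
    refine mem_idealOfForms_of_eval hx (by norm_num) (fun i => hl i i.isLt) hf
      fun i j hij a ha c hc => h (a, c) ?_
    rw [List.mem_toFinset, mem_edgeList]
    rw [mem_lineBlock] at ha hc
    obtain ⟨ha1, ha2, ha3⟩ := ha
    obtain ⟨hc1, hc2, hc3⟩ := hc
    simp only [ha1, ha2, hc1, hc2]
    exact ⟨by simp, trivial, hij, j.isLt, ha3, hc3⟩

end IdealOfForms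

section Defective

variable {k : Type*} [Field k]

theorem gradedDim_formsOfLines {r : ℕ} {l : ℕ → ℕ} {x : ℕ × ℕ × ℕ → Fin 3 → k}
    (hx : IsGeneric (lineSupport r (∑ i ∈ range r, l i)) x) (n : ℕ) :
    gradedDim (idealOfForms (formsOfLines x 0 fun i : Fin r => l i) ⊓
      idealOfForms (formsOfLines x 1 fun i : Fin r => l i)) n =
    Module.finrank k (vanishing (edgeList r l).toFinset x n) := by
  rw [gradedDim, inf_homogeneousSubmodule_eq_vanishing hx
    fun i hi => single_le_sum (fun _ _ => Nat.zero_le _) (mem_range.2 hi)]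

/-- The intersection of `I_F` and `I_G` contains the multiples of `∏_{i ≥ 2} F_i G_i`. -/
theorem choose_le_gradedDim {m : ℕ} {d : Fin (m + 1) → ℕ}
    {F G : Fin (m + 1) → MvPolynomial (Fin 3) k}
    (hF : ∀ i, F i ≠ 0 ∧ (F i).IsHomogeneous (d i))
    (hG : ∀ i, G i ≠ 0 ∧ (G i).IsHomogeneous (d i)) (n : ℕ) :
    (n + 2).choose 2 ≤
      gradedDim (idealOfForms F ⊓ idealOfForms G) (2 * ∑ i : Fin m, d i.succ + n) := by
  set P := ∏ i : Fin m, F i.succ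
  set Q := ∏ i : Fin m, G i.succ
  have hPQ : P * Q ≠ 0 := mul_ne_zero (prod_ne_zero_iff.2 fun i _ => (hF i.succ).1)
    (prod_ne_zero_iff.2 fun i _ => (hG i.succ).1)
  have hdeg : (P * Q).IsHomogeneous (2 * ∑ i : Fin m, d i.succ) := by
    rw [two_mul]
    exact (IsHomogeneous.prod _ _ _ fun i _ => (hF i.succ).2).mul
      (IsHomogeneous.prod _ _ _ fun i _ => (hG i.succ).2)
  have hmem {H : Fin (m + 1) → MvPolynomial (Fin 3) k} {f : MvPolynomial (Fin 3) k}
      (h : (∏ i : Fin m, H i.succ) ∣ f) : f ∈ idealOfForms H := by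
    rw [mem_idealOfForms]
    intro i j hij
    obtain ⟨j, rfl⟩ := Fin.exists_succ_eq.2 (Fin.ne_zero_of_lt hij)
    exact Ideal.mem_of_dvd _ ((dvd_prod_of_mem (fun i : Fin m => H i.succ) (mem_univ j)).trans h)
      (Ideal.subset_span (by simp))
  rw [← finrank_homogeneousSubmodule_fin_three (k := k), gradedDim]
  have : Module.Finite k (homogeneousSubmodule (Fin 3) k (2 * ∑ i : Fin m, d i.succ + n)) :=
    inferInstance
  rw [((homogeneousSubmodule (Fin 3) k n).equivMapOfInjective (LinearMap.mulLeft k (P * Q))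
    (mul_right_injective₀ hPQ)).finrank_eq]
  refine Submodule.finrank_mono ?_
  rintro _ ⟨f, hf, rfl⟩
  exact ⟨⟨hmem ⟨Q * f, by rw [LinearMap.mulLeft_apply, mul_assoc]⟩,
    hmem ⟨P * f, by rw [LinearMap.mulLeft_apply]; ring⟩⟩, hdeg.mul hf⟩

theorem exists_formsOfLines_gradedDim [Infinite k] {r N : ℕ} {l : ℕ → ℕ}
    (h : TypeBound k r l N) :
    ∃ F G : Fin r → MvPolynomial (Fin 3) k,
      (∀ i, F i ≠ 0 ∧ (F i).IsHomogeneous (l i)) ∧ (∀ i, G i ≠ 0 ∧ (G i).IsHomogeneous (l i)) ∧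
      gradedDim (idealOfForms F ⊓ idealOfForms G) (∑ i ∈ range r, l i) ≤ N ∧
      (∑ i ∈ range r, l i + 2).choose 2 ≤ (edgeList r l).length +
        gradedDim (idealOfForms F ⊓ idealOfForms G) (∑ i ∈ range r, l i) := by
  obtain ⟨x, hx, hN⟩ := GenBound.exists_isGeneric h (lineSupport r (∑ i ∈ range r, l i))
  have hl (i : Fin r) : l i ≤ ∑ i ∈ range r, l i :=
    single_le_sum (f := l) (fun _ _ => Nat.zero_le _) (mem_range.2 i.isLt)
  refine ⟨_, _, fun i => ⟨formsOfLines_ne_zero hx (by norm_num) hl i,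
    isHomogeneous_formsOfLines x 0 _ i⟩, fun i => ⟨formsOfLines_ne_zero hx (by norm_num) hl i,
    isHomogeneous_formsOfLines x 1 _ i⟩, ?_⟩
  rw [gradedDim_formsOfLines hx]
  exact ⟨hN, (choose_le_card_add_finrank_vanishing _ x _).trans
    (Nat.add_le_add_right (List.toFinset_card_le _) _)⟩

end Defective

/-- Main Theorem (ideal-theoretic form): `σ₂(X_{2,λ})` is nondefective, i.e. for
general `[F], [G] ∈ X_{2,λ}` the space `(I_F ∩ I_G)_d` has the expected dimension
`max {0, C(d+2,2) - 2D}`, if and only if it is not the case that both `d₁ ≥ s` and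
`2p - 3s > 0`. -/
theorem secant_line_variety_defective_iff
    {k : Type*} [Field k] [IsAlgClosed k]
    (r : ℕ) [NeZero r] (hr : 2 ≤ r)
    (d : Fin r → ℕ)
    (hanti : ∀ i j : Fin r, i ≤ j → d j ≤ d i)
    (hpos : ∀ i, 1 ≤ d i) :
    (∃ F G : Fin r → MvPolynomial (Fin 3) k,
      (∀ i, F i ≠ 0 ∧ (F i).IsHomogeneous (d i)) ∧
      (∀ i, G i ≠ 0 ∧ (G i).IsHomogeneous (d i)) ∧
      (gradedDim (idealOfForms F ⊓ idealOfForms G) (∑ i, d i) : ℤ) =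
        max 0 ((((∑ i, d i) + 2).choose 2 : ℤ) - 2 * Dval d)) ↔
    ¬ (sval d ≤ d 0 ∧ 3 * sval d < 2 * pval d) := by
  obtain ⟨m, rfl⟩ : ∃ m, r = m + 1 := ⟨r - 1, by omega⟩
  obtain ⟨l, rfl⟩ : ∃ l : ℕ → ℕ, d = fun i : Fin (m + 1) => l i :=
    ⟨fun i => if h : i < m + 1 then d ⟨i, h⟩ else 0, by
      ext i
      simp only [Fin.is_lt, dite_true, Fin.eta]⟩
  have hsum (f : ℕ → ℕ) : ∑ i : Fin (m + 1), f (l i) = ∑ i ∈ range (m + 1), f (l i) :=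
    (sum_range fun i => f (l i)).symm
  have hsum' (f : ℕ → ℕ) : ∑ i ∈ univ.filter (fun i : Fin (m + 1) => i.val ≠ 0), f (l i) =
      ∑ i ∈ range m, f (l (i + 1)) := by
    rw [sum_filter_val_ne_zero, sum_range]
    rfl
  have hs : sval (fun i : Fin (m + 1) => l i) = ∑ i ∈ range m, l (i + 1) := hsum' id
  have hd : ∑ i : Fin (m + 1), l i = ∑ i ∈ range (m + 1), l i := hsum id
  have hD := two_mul_Dval_add fun i : Fin (m + 1) => l i
  have hp := two_mul_pval_add fun i : Fin (m + 1) => l i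
  rw [hsum (· ^ 2), hd] at hD
  rw [hsum' (· ^ 2), hs] at hp
  have hsucc : ∑ i ∈ range (m + 1), l i = ∑ i ∈ range m, l (i + 1) + l 0 := sum_range_succ' l m
  have h0 : l ((0 : Fin (m + 1)) : ℕ) = l 0 := rfl
  simp only [hs, hd, h0]
  constructor
  · rintro ⟨F, G, hF, hG, h⟩ ⟨h1, h2⟩
    obtain ⟨n, hn⟩ := Nat.exists_eq_add_of_le h1
    have hle := choose_le_gradedDim hF hG n
    have hsum_succ : ∑ i : Fin m, l (i.succ : Fin (m + 1)) = ∑ i ∈ range m, l (i + 1) :=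
      (sum_range fun i => l (i + 1)).symm
    have hdeg : 2 * ∑ i ∈ range m, l (i + 1) + n = ∑ i ∈ range (m + 1), l i := by omega
    rw [hsum_succ, hdeg] at hle
    have hsq : ∑ i ∈ range (m + 1), l i ^ 2 = ∑ i ∈ range m, l (i + 1) ^ 2 + l 0 ^ 2 :=
      sum_range_succ' (fun i => l i ^ 2) m
    have hpos' : 0 < (n + 2).choose 2 := Nat.choose_pos (by omega)
    have hC (a : ℕ) : 2 * (a + 2).choose 2 = (a + 2) * (a + 1) := by
      have := Nat.add_one_mul_choose_eq (a + 1) 1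
      rw [Nat.choose_one_right] at this
      linarith
    have hCd := hC (∑ i ∈ range (m + 1), l i)
    have hCn := hC n
    have hexp : ((∑ i ∈ range (m + 1), l i + 2).choose 2 : ℤ) -
        2 * Dval (fun i : Fin (m + 1) => l i) < (n + 2).choose 2 := by
      rw [hsq] at hD
      rw [← hdeg] at hD hCd ⊢
      rw [hn] at hD
      zify at hD hp hCd hCn h2
      linarith
    zify at hle hpos'
    rw [h] at hle
    rcases le_max_iff.1 hle with h3 | h3 <;> linarith
  · intro h
    have hm : 0 < m := by omega
    have hanti' : ∀ i < m, l (i + 1) ≤ l i := fun i hi =>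
      hanti ⟨i, by omega⟩ ⟨i + 1, by omega⟩ (Fin.le_def.2 (Nat.le_succ i))
    have hlen := length_edgeList (m + 1) l
    have hlen' := two_mul_sum_sum_range_add l (m + 1)
    have hexp : expectedDim (m + 1) l = ((∑ i ∈ range (m + 1), l i + 2).choose 2 : ℤ) -
        2 * Dval (fun i : Fin (m + 1) => l i) := by
      rw [expectedDim]
      zify at hD
      linarith
    have hN : ∃ N : ℕ, (N : ℤ) ≤ max 0 (expectedDim (m + 1) l) ∧ TypeBound k (m + 1) l N := by
      obtain ⟨N, hN, hT⟩ | hT := isExact_or_typeBound_zero (k := k) hm hanti' (hpos (Fin.last m))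
        (fun ⟨h1, h2⟩ => h ⟨h1, by omega⟩)
      · exact ⟨N, hN.trans (le_max_right _ _), hT⟩
      · exact ⟨0, le_max_left _ _, hT⟩
    obtain ⟨N, hN, hT⟩ := hN
    obtain ⟨F, G, hF, hG, h1, h2⟩ := exists_formsOfLines_gradedDim hT
    refine ⟨F, G, hF, hG, ?_⟩
    rw [hexp] at hN
    refine le_antisymm ((Int.ofNat_le.2 h1).trans hN) (max_le (Int.natCast_nonneg _) ?_)
    omega
end

section
/- Let k be an algebraically closed field and let r ≥ 2 and d₁ ≥ d₂ ≥ ⋯ ≥ d_r ≥ 1 be integers with d₁ ≥ s and 2p − 3s > 0 (where s = d₂+⋯+d_r, D = Σ_{1≤i<j≤r} d_i d_j, p = D − d₁s, d = d₁+⋯+d_r). Then: (i) for EVERY choice of nonzero homogeneous polynomials F₁,…,F_r, G₁,…,G_r ∈ k[x₀,x₁,x₂] with deg F_i = deg G_i = d_i one has dim_k (I_F ∩ I_G)_d ≥ C(d₁−s+2, 2); and (ii) C(d₁−s+2, 2) > max{0, C(d+2,2) − 2D}. (This is the defective direction of the Main Theorem: under these hypotheses σ₂(X_{2,λ}) is defective.)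 -/
open MvPolynomial Finset

lemma homogeneousSubmodule_eq_restrictSupport (σ R : Type*) [CommSemiring R] (n : ℕ) :
    homogeneousSubmodule σ R n = restrictSupport R {m : σ →₀ ℕ | m.degree = n} :=
  homogeneousSubmodule_eq_finsupp_supported σ R n

lemma card_degree_eq (σ : Type*) [Fintype σ] (n : ℕ) :
    Nat.card {m : σ →₀ ℕ | m.degree = n} = (Fintype.card σ).multichoose n := by
  classical
  rw [← Sym.card_sym_eq_multichoose σ n, ← Nat.card_eq_fintype_card]
  exact Nat.card_congr (Sym.equivNatSum σ n).symm

instance finite_homogeneousSubmodule (σ R : Type*) [Finite σ] [CommRing R] (n : ℕ) :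
    Module.Finite R (homogeneousSubmodule σ R n) := by
  classical
  have := Fintype.ofFinite σ
  have : Finite {m : σ →₀ ℕ | m.degree = n} := Finite.of_equiv _ (Sym.equivNatSum σ n)
  rw [homogeneousSubmodule_eq_restrictSupport]
  exact .of_basis (basisRestrictSupport R _)

lemma finrank_homogeneousSubmodule (σ R : Type*) [Fintype σ] [CommRing R] [Nontrivial R] (n : ℕ) :
    Module.finrank R (homogeneousSubmodule σ R n) = (Fintype.card σ).multichoose n := by
  rw [homogeneousSubmodule_eq_restrictSupport,
    Module.finrank_eq_nat_card_basis (basisRestrictSupport R _), card_degree_eq]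

/-- Multiplication by a nonzero form of degree `e` in `I` embeds the forms of degree `m` into
the degree-`(e + m)` part of `I`. -/
lemma choose_le_gradedDim_s1 {k : Type*} [Field k] {I : Ideal (MvPolynomial (Fin 3) k)}
    {H : MvPolynomial (Fin 3) k} {e : ℕ} (hH : H ≠ 0) (hom : H.IsHomogeneous e) (hI : H ∈ I)
    (m : ℕ) : (m + 2).choose 2 ≤ gradedDim I (e + m) := by
  have hdim : Module.finrank k (homogeneousSubmodule (Fin 3) k m) = (m + 2).choose 2 := by
    rw [finrank_homogeneousSubmodule, Fintype.card_fin, Nat.multichoose_eq,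
      show 3 + m - 1 = m + 2 by omega, Nat.choose_symm_add]
  have : Module.Finite k
      ↥(Submodule.restrictScalars k I ⊓ homogeneousSubmodule (Fin 3) k (e + m)) :=
    Submodule.finiteDimensional_of_le inf_le_right
  rw [← hdim, gradedDim]
  refine LinearMap.finrank_le_finrank_of_injective
    (f := (LinearMap.mulLeft k H).restrict fun P hP =>
      ⟨I.mul_mem_right P hI, hom.mul hP⟩) fun P Q hPQ => ?_
  exact Subtype.ext (mul_left_cancel₀ hH (congrArg Subtype.val hPQ))

lemma prod_mem_idealOfForms {k : Type*} [Field k] {r : ℕ} (F : Fin r → MvPolynomial (Fin 3) k) :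
    ∏ i ∈ univ.filter (fun i : Fin r => i.val ≠ 0), F i ∈ idealOfForms F := by
  simp only [idealOfForms, Submodule.mem_iInf]
  intro i j hij
  have hj : j ∈ univ.filter (fun i : Fin r => i.val ≠ 0) := by
    have : i.val < j.val := hij
    simp only [mem_filter, mem_univ, true_and]
    omega
  exact Ideal.mem_of_dvd _ (dvd_prod_of_mem F hj) (Ideal.subset_span (by simp))

lemma sum_eq_add_sval {r : ℕ} [NeZero r] (d : Fin r → ℕ) : ∑ i, d i = d 0 + sval d := by
  have : univ.filter (fun i : Fin r => i.val ≠ 0) = univ.erase 0 := by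
    ext i
    simp [Fin.val_eq_zero_iff]
  rw [sval, this, add_sum_erase _ _ (mem_univ _)]

lemma Dval_eq {r : ℕ} [NeZero r] (d : Fin r → ℕ) : Dval d = d 0 * sval d + pval d := by
  rw [Dval, ← sum_filter_add_sum_filter_not _ (fun q : Fin r × Fin r => q.1.val = 0),
    filter_filter, filter_filter]
  congr 1
  rw [sval, mul_sum]
  refine sum_bij' (fun q _ => q.2) (fun j _ => (0, j)) ?_ ?_ ?_ ?_ ?_ <;>
    simp +contextual [Fin.val_eq_zero_iff, Fin.pos_iff_ne_zero]
  rintro a b hab rfl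
  exact (Fin.pos_iff_ne_zero' b).mp hab

lemma add_two_choose_two (n : ℕ) : 2 * ((n + 2).choose 2 : ℤ) = (n + 2) * (n + 1) := by
  have h := Nat.add_one_mul_choose_eq (n + 1) 1
  rw [Nat.choose_one_right] at h
  zify at h
  linarith

/-- Defective direction of the Main Theorem: if `d₁ ≥ s` and `2p - 3s > 0`, then for
every choice of nonzero forms of the given degrees, `dim (I_F ∩ I_G)_d ≥ C(d₁-s+2, 2)`,
and this lower bound exceeds the expected dimension `max {0, C(d+2,2) - 2D}`. -/
theorem secant_line_variety_defective_case
    {k : Type*} [Field k] [IsAlgClosed k]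
    (r : ℕ) [NeZero r] (hr : 2 ≤ r)
    (d : Fin r → ℕ)
    (hanti : ∀ i j : Fin r, i ≤ j → d j ≤ d i)
    (hpos : ∀ i, 1 ≤ d i)
    (hds : sval d ≤ d 0)
    (hps : 3 * sval d < 2 * pval d) :
    (∀ F G : Fin r → MvPolynomial (Fin 3) k,
      (∀ i, F i ≠ 0 ∧ (F i).IsHomogeneous (d i)) →
      (∀ i, G i ≠ 0 ∧ (G i).IsHomogeneous (d i)) →
      (d 0 + 2 - sval d).choose 2 ≤
        gradedDim (idealOfForms F ⊓ idealOfForms G) (∑ i, d i)) ∧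
    max 0 ((((∑ i, d i) + 2).choose 2 : ℤ) - 2 * Dval d) <
      ((d 0 + 2 - sval d).choose 2 : ℤ) := by
  obtain ⟨m, hm⟩ := Nat.exists_eq_add_of_le hds
  have hsum := sum_eq_add_sval d
  have hsub : d 0 + 2 - sval d = m + 2 := by omega
  rw [hsub]
  refine ⟨fun F G hF hG => ?_, max_lt ?_ ?_⟩
  · have hdeg : ∑ i, d i = sval d + sval d + m := by omega
    rw [hdeg]
    refine choose_le_gradedDim_s1
      (mul_ne_zero (prod_ne_zero_iff.mpr fun i _ => (hF i).1)
        (prod_ne_zero_iff.mpr fun i _ => (hG i).1))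
      ((IsHomogeneous.prod _ F d fun i _ => (hF i).2).mul
        (IsHomogeneous.prod _ G d fun i _ => (hG i).2))
      (Submodule.mem_inf.mpr ⟨Ideal.mul_mem_right _ _ (prod_mem_idealOfForms F),
        Ideal.mul_mem_left _ _ (prod_mem_idealOfForms G)⟩) m
  · exact_mod_cast Nat.choose_pos (by omega)
  · have h₁ := add_two_choose_two (∑ i, d i)
    have h₂ := add_two_choose_two m
    have hD := Dval_eq d
    rw [hsum] at h₁ ⊢
    rw [hm] at h₁ hD ⊢
    zify at hps hD
    push_cast at h₁ hD ⊢
    rw [hD]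
    nlinarith
end
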